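/- Let p ≥ 2, c > 0, and assume A_{i,j} ≥ κ hᵢ for all i, j with κ > 0, and that the partition is σ-shape-regular (max hᵢ ≤ σ min hᵢ). Let u ∈ W̃_β^{2p+1,∞} be an exact solution of −(βu′)′ + γu′ + cu = f on (a,α) ∪ (α,b) with u(a) = u(b) = 0, and let u_T ∈ U_T be an IFVM solution with the same data f. For each i, let Lᵢ be a polynomial of degree p with ∫_{τᵢ} Lᵢ(x) q(x)/β(x) dx = 0 for every polynomial q of degree < p, and define the generalized Lobatto function φᵢ(x) = ∫_{x_{i−1}}^{x} Lᵢ(t)/β(t) dt. Then there exist h₀ > 0 and C > 0, depending only on p, β⁻, β⁺, γ, c, κ, σ and b−a, such that for h ≤ h₀ and every point z ∈ τᵢ with φᵢ(z) = 0 (a generalized Lobatto point), the superconvergence bound |u(z) − u_T(z)| ≤ C h^{p+2} ‖u‖_{2p+1,∞} holds. -/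

import Mathlib

open Set

/-- The piecewise-constant diffusion coefficient with interface point `α`. -/
noncomputable def betaPW (βm βp α : ℝ) : ℝ → ℝ := fun t => if t < α then βm else βp

/-- Membership in the immersed trial space `U_T`: continuous on `[a,b]`, zero boundary
values, a polynomial of degree ≤ p on each non-interface element `[x_{i-1}, x_i]` (i ≠ k),
and on the interface element `[x_{k-1}, x_k]` a continuous piecewise polynomial of degree ≤ p
satisfying the derivative jump conditions at the interface `α`. -/
def MemUT (p N k : ℕ) (a b α βm βp : ℝ) (x : ℕ → ℝ) (v : ℝ → ℝ) : Prop :=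
  ContinuousOn v (Set.Icc a b) ∧ v a = 0 ∧ v b = 0 ∧
  (∀ i, 1 ≤ i → i ≤ N → i ≠ k → ∃ q : Polynomial ℝ, q.natDegree ≤ p ∧
    ∀ y ∈ Set.Icc (x (i - 1)) (x i), v y = q.eval y) ∧
  ∃ qm qp : Polynomial ℝ, qm.natDegree ≤ p ∧ qp.natDegree ≤ p ∧
    (∀ y ∈ Set.Icc (x (k - 1)) α, v y = qm.eval y) ∧
    (∀ y ∈ Set.Icc α (x k), v y = qp.eval y) ∧
    ∀ j, 1 ≤ j → j ≤ p →
      βm * ((⇑Polynomial.derivative)^[j] qm).eval α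
        = βp * ((⇑Polynomial.derivative)^[j] qp).eval α

/-- Membership in `W̃_β^{m,∞}`: continuous on `[a,b]`, zero boundary values, `C^m` on each
of `[a,α]` and `[α,b]`, and satisfying the flux jump conditions at `α` for `j = 1,…,m`. -/
def MemW (m : ℕ) (a b α βm βp : ℝ) (u : ℝ → ℝ) : Prop :=
  ContinuousOn u (Set.Icc a b) ∧ u a = 0 ∧ u b = 0 ∧
  ContDiffOn ℝ (m : ℕ∞) u (Set.Icc a α) ∧ ContDiffOn ℝ (m : ℕ∞) u (Set.Icc α b) ∧
  ∀ j, 1 ≤ j → j ≤ m →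
    βm * iteratedDerivWithin j u (Set.Icc a α) α
      = βp * iteratedDerivWithin j u (Set.Icc α b) α

/-- The broken `W^{m,∞}` norm `‖u‖_{m,∞}`: maximum of the piecewise `W^{m,∞}` norms on
`[a,α]` and `[α,b]`. -/
noncomputable def wnorm (m : ℕ) (a b α : ℝ) (u : ℝ → ℝ) : ℝ :=
  max (sSup {y : ℝ | ∃ j ≤ m, ∃ t ∈ Set.Icc a α,
        y = |iteratedDerivWithin j u (Set.Icc a α) t|})
      (sSup {y : ℝ | ∃ j ≤ m, ∃ t ∈ Set.Icc α b,
        y = |iteratedDerivWithin j u (Set.Icc α b) t|})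

/-- A continuous function whose derivative is nonnegative off one point increases. -/
theorem le_of_hasDerivAt_nonneg_off {f f' : ℝ → ℝ} {l r α : ℝ} (hlr : l ≤ r)
    (hc : ContinuousOn f (Icc l r))
    (hd : ∀ t ∈ Ioo l r, t ≠ α → HasDerivAt f (f' t) t)
    (h0 : ∀ t ∈ Ioo l r, t ≠ α → 0 ≤ f' t) : f l ≤ f r := by
  have key : ∀ l' r' : ℝ, l ≤ l' → l' ≤ r' → r' ≤ r → α ∉ Ioo l' r' → f l' ≤ f r' := by
    intro l' r' h1 h2 h3 hα
    have hne : ∀ t ∈ Ioo l' r', t ∈ Ioo l r ∧ t ≠ α := fun t ht =>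
      ⟨⟨h1.trans_lt ht.1, ht.2.trans_le h3⟩, fun h => hα (h ▸ ht)⟩
    refine monotoneOn_of_deriv_nonneg (convex_Icc l' r') (hc.mono (Icc_subset_Icc h1 h3)) ?_ ?_
      (left_mem_Icc.2 h2) (right_mem_Icc.2 h2) h2
    · rw [interior_Icc]
      exact fun t ht =>
        (hd t (hne t ht).1 (hne t ht).2).differentiableAt.differentiableWithinAt
    · rw [interior_Icc]
      intro t ht
      rw [(hd t (hne t ht).1 (hne t ht).2).deriv]
      exact h0 t (hne t ht).1 (hne t ht).2
  by_cases hα : α ∈ Ioo l r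
  · exact (key l α le_rfl hα.1.le hα.2.le (fun h => lt_irrefl _ h.2)).trans
      (key α r hα.1.le hα.2.le le_rfl (fun h => lt_irrefl _ h.1))
  · exact key l r le_rfl hlr le_rfl hα

/-- The mean value inequality for a derivative bounded off one point. -/
theorem abs_sub_le_of_hasDerivAt_off {f f' : ℝ → ℝ} {l r α B : ℝ} (hlr : l ≤ r)
    (hc : ContinuousOn f (Icc l r))
    (hd : ∀ t ∈ Ioo l r, t ≠ α → HasDerivAt f (f' t) t)
    (hB : ∀ t ∈ Ioo l r, t ≠ α → |f' t| ≤ B) : |f r - f l| ≤ B * (r - l) := by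
  have h1 : B * l - f l ≤ B * r - f r :=
    le_of_hasDerivAt_nonneg_off (f := fun t => B * t - f t) (f' := fun t => B * 1 - f' t) (α := α)
      hlr (by fun_prop) (fun t ht hne => ((hasDerivAt_id t).const_mul B).sub (hd t ht hne))
      (fun t ht hne => by linarith [(abs_le.1 (hB t ht hne)).2])
  have h2 : B * l + f l ≤ B * r + f r :=
    le_of_hasDerivAt_nonneg_off (f := fun t => B * t + f t) (f' := fun t => B * 1 + f' t) (α := α)
      hlr (by fun_prop) (fun t ht hne => ((hasDerivAt_id t).const_mul B).add (hd t ht hne))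
      (fun t ht hne => by linarith [(abs_le.1 (hB t ht hne)).1])
  rw [abs_le]
  constructor <;> linarith

theorem Polynomial.exists_derivative_eq (s : Polynomial ℝ) :
    ∃ S : Polynomial ℝ, Polynomial.derivative S = s ∧ S.natDegree ≤ s.natDegree + 1 := by
  refine ⟨∑ n ∈ Finset.range (s.natDegree + 1),
    Polynomial.monomial (n + 1) (s.coeff n / (n + 1)), ?_, ?_⟩
  · rw [Polynomial.derivative_sum]
    conv_rhs => rw [s.as_sum_range]
    refine Finset.sum_congr rfl fun n _ => ?_
    rw [Polynomial.derivative_monomial]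
    have : (n : ℝ) + 1 ≠ 0 := by positivity
    simp only [Nat.add_sub_cancel]
    push_cast
    rw [div_mul_cancel₀ _ this]
  · refine Polynomial.natDegree_sum_le_of_forall_le _ _ fun n hn => ?_
    refine (Polynomial.natDegree_monomial_le _).trans ?_
    have := Finset.mem_range.1 hn
    omega

/-- Taylor's theorem for a family of successive derivatives, allowing one exceptional point. -/
theorem exists_polynomial_approx {l r α B : ℝ} (hlr : l ≤ r) (hB : 0 ≤ B) (n : ℕ)
    (D : ℕ → ℝ → ℝ) (hc : ∀ j ≤ n, ContinuousOn (D j) (Icc l r))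
    (hd : ∀ j ≤ n, ∀ t ∈ Ioo l r, t ≠ α → HasDerivAt (D j) (D (j + 1) t) t)
    (hD : ∀ t ∈ Ioo l r, |D (n + 1) t| ≤ B) :
    ∃ T : Polynomial ℝ, T.natDegree ≤ n ∧
      ∀ t ∈ Icc l r, |D 0 t - T.eval t| ≤ B * (r - l) ^ (n + 1) := by
  induction n generalizing D with
  | zero =>
    refine ⟨Polynomial.C (D 0 l), by simp, fun t ht => ?_⟩
    have h := abs_sub_le_of_hasDerivAt_off (f := D 0) (f' := D 1) (α := α) (B := B) ht.1
      ((hc 0 le_rfl).mono (Icc_subset_Icc_right ht.2))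
      (fun s hs hne => hd 0 le_rfl s ⟨hs.1, hs.2.trans_le ht.2⟩ hne)
      (fun s hs _ => hD s ⟨hs.1, hs.2.trans_le ht.2⟩)
    simp only [Polynomial.eval_C, zero_add, pow_one]
    exact h.trans (mul_le_mul_of_nonneg_left (by linarith [ht.2]) hB)
  | succ n ih =>
    obtain ⟨T, hT, hTb⟩ := ih (fun j => D (j + 1)) (fun j hj => hc _ (by omega))
      (fun j hj => hd _ (by omega)) hD
    obtain ⟨S, hS, hSd⟩ := T.exists_derivative_eq
    refine ⟨S + Polynomial.C (D 0 l - S.eval l), ?_, fun t ht => ?_⟩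
    · rw [Polynomial.natDegree_add_C]
      omega
    · have h := abs_sub_le_of_hasDerivAt_off (f := fun y => D 0 y - S.eval y)
        (f' := fun y => D 1 y - T.eval y) (α := α) (B := B * (r - l) ^ (n + 1)) ht.1
        (((hc 0 (by omega)).mono (Icc_subset_Icc_right ht.2)).sub S.continuous.continuousOn)
        (fun s hs hne => (hd 0 (by omega) s ⟨hs.1, hs.2.trans_le ht.2⟩ hne).sub
          (by rw [← hS]; exact S.hasDerivAt s))
        (fun s hs _ => hTb s ⟨hs.1.le, (hs.2.trans_le ht.2).le⟩)
      have e : D 0 t - (S + Polynomial.C (D 0 l - S.eval l)).eval t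
          = (D 0 t - S.eval t) - (D 0 l - S.eval l) := by
        rw [Polynomial.eval_add, Polynomial.eval_C]; ring
      rw [e]
      refine h.trans ?_
      rw [pow_succ _ (n + 1), ← mul_assoc]
      have : 0 ≤ r - l := by linarith
      exact mul_le_mul_of_nonneg_left (by linarith [ht.2]) (by positivity)

/-- On polynomials of bounded degree the sup norm on `[0,1]` is controlled by the `L²` norm. -/
theorem exists_sq_eval_le_integral (p : ℕ) : ∃ C : ℝ, 0 < C ∧ ∀ s : Polynomial ℝ,
    s.natDegree < p → ∀ t ∈ Icc (0 : ℝ) 1,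
      (s.eval t) ^ 2 ≤ C * ∫ y in (0 : ℝ)..1, (s.eval y) ^ 2 := by
  rcases Nat.eq_zero_or_pos p with rfl | hp
  · exact ⟨1, one_pos, fun s hs => absurd hs (by omega)⟩
  have : Nonempty (Fin p) := ⟨⟨0, hp⟩⟩
  set φ : (Fin p → ℝ) → ℝ → ℝ := fun v y => ∑ i, v i * y ^ (i : ℕ) with hφ
  have hφc : Continuous (Function.uncurry fun (v : Fin p → ℝ) (y : ℝ) => (φ v y) ^ 2) := by
    simp only [hφ, Function.uncurry_def]
    fun_prop
  have hcont : Continuous fun v : Fin p → ℝ => ∫ y in (0 : ℝ)..1, (φ v y) ^ 2 :=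
    intervalIntegral.continuous_parametric_intervalIntegral_of_continuous' hφc 0 1
  have hne : (Metric.sphere (0 : Fin p → ℝ) 1).Nonempty := by
    refine ⟨fun _ => 1, ?_⟩
    rw [mem_sphere_zero_iff_norm]
    simp
  obtain ⟨v₀, hv₀, hmin⟩ := (isCompact_sphere (0 : Fin p → ℝ) 1).exists_isMinOn hne
    hcont.continuousOn
  set δ := ∫ y in (0 : ℝ)..1, (φ v₀ y) ^ 2 with hδ
  have hφ1 : ∀ v, Continuous fun y => (φ v y) ^ 2 := fun v => by simp only [hφ]; fun_prop
  have hδpos : 0 < δ := by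
    refine lt_of_le_of_ne (intervalIntegral.integral_nonneg zero_le_one fun y _ => sq_nonneg _) ?_
    intro h0
    have hzero : ∀ y ∈ Icc (0 : ℝ) 1, φ v₀ y = 0 := by
      by_contra! hcon
      obtain ⟨y, hy, hy0⟩ := hcon
      have := intervalIntegral.integral_pos (a := (0 : ℝ)) (b := 1)
        (f := fun y => (φ v₀ y) ^ 2) zero_lt_one (hφ1 v₀).continuousOn
        (fun y _ => sq_nonneg _) ⟨y, hy, by positivity⟩
      linarith
    set P : Polynomial ℝ := ∑ i : Fin p, Polynomial.C (v₀ i) * Polynomial.X ^ (i : ℕ) with hP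
    have hPe : ∀ y, P.eval y = φ v₀ y := fun y => by
      simp [hP, hφ, Polynomial.eval_finsetSum]
    have hP0 : P = 0 := by
      refine Polynomial.eq_zero_of_infinite_isRoot P ((Icc_infinite zero_lt_one).mono ?_)
      exact fun y hy => by
        show P.eval y = 0
        rw [hPe, hzero y hy]
    have hv0 : v₀ = 0 := by
      funext i
      have hcf : P.coeff i = v₀ i := by
        simp only [hP, Polynomial.finsetSum_coeff, Polynomial.coeff_C_mul_X_pow]
        rw [Finset.sum_eq_single i]
        · simp
        · intro j _ hj
          rw [if_neg]
          exact fun h => hj (Fin.ext h.symm)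
        · simp
      rw [← hcf, hP0]
      simp
    rw [hv0] at hv₀
    simp at hv₀
  have hlow : ∀ v : Fin p → ℝ, δ * ‖v‖ ^ 2 ≤ ∫ y in (0 : ℝ)..1, (φ v y) ^ 2 := by
    intro v
    rcases eq_or_ne v 0 with rfl | hv
    · simp [hφ]
    have hn : 0 < ‖v‖ := norm_pos_iff.2 hv
    have h1 : δ ≤ ∫ y in (0 : ℝ)..1, (φ (‖v‖⁻¹ • v) y) ^ 2 :=
      hmin (by rw [mem_sphere_zero_iff_norm, norm_smul, norm_inv, norm_norm]; field_simp)
    have h2 : ∀ y, (φ (‖v‖⁻¹ • v) y) ^ 2 = (‖v‖⁻¹) ^ 2 * (φ v y) ^ 2 := by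
      intro y
      have : φ (‖v‖⁻¹ • v) y = ‖v‖⁻¹ * φ v y := by
        simp only [hφ, Pi.smul_apply, smul_eq_mul, Finset.mul_sum, mul_assoc]
      rw [this, mul_pow]
    simp only [h2] at h1
    rw [intervalIntegral.integral_const_mul] at h1
    calc δ * ‖v‖ ^ 2 ≤ ((‖v‖⁻¹) ^ 2 * ∫ y in (0 : ℝ)..1, (φ v y) ^ 2) * ‖v‖ ^ 2 :=
          mul_le_mul_of_nonneg_right h1 (by positivity)
      _ = _ := by field_simp
  refine ⟨(p : ℝ) ^ 2 / δ, by positivity, fun s hs t ht => ?_⟩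
  set v : Fin p → ℝ := fun i => s.coeff i
  have hse : ∀ y, s.eval y = φ v y := fun y => by
    rw [Polynomial.eval_eq_sum_range' hs, Finset.sum_range]
  have habs : |φ v t| ≤ p * ‖v‖ := by
    calc |φ v t| ≤ ∑ i, |v i * t ^ (i : ℕ)| := Finset.abs_sum_le_sum_abs _ _
      _ ≤ ∑ _i : Fin p, ‖v‖ := by
          refine Finset.sum_le_sum fun i _ => ?_
          rw [abs_mul, abs_of_nonneg (pow_nonneg ht.1 _)]
          exact (mul_le_of_le_one_right (abs_nonneg _) (pow_le_one₀ ht.1 ht.2)).trans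
            (norm_le_pi_norm v i)
      _ = p * ‖v‖ := by simp
  simp only [hse]
  calc (φ v t) ^ 2 = |φ v t| ^ 2 := (sq_abs _).symm
    _ ≤ (p * ‖v‖) ^ 2 := by gcongr
    _ = (p : ℝ) ^ 2 / δ * (δ * ‖v‖ ^ 2) := by field_simp
    _ ≤ _ := by gcongr; exact hlow v

/-- A `p`-point quadrature rule on `[l,r]` with positive weights, exact for the weight `1/β` on
polynomials of degree at most `2p-1`. -/
structure IsGaussRule (p : ℕ) (m M : ℝ) (β : ℝ → ℝ) (l r : ℝ) (y A : ℕ → ℝ) : Prop where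
  one_le : 1 ≤ p
  lt : l < r
  pos : 0 < m
  meas : Measurable β
  lower : ∀ t, m ≤ β t
  upper : ∀ t, β t ≤ M
  mem : ∀ j ∈ Finset.Icc 1 p, y j ∈ Ioo l r
  ne : ∀ i ∈ Finset.Icc 1 p, ∀ j ∈ Finset.Icc 1 p, i ≠ j → y i ≠ y j
  weight_pos : ∀ j ∈ Finset.Icc 1 p, 0 < A j
  exact : ∀ F : Polynomial ℝ, F.natDegree ≤ 2 * p - 1 →
    ∑ j ∈ Finset.Icc 1 p, A j * F.eval (y j) = ∫ t in l..r, F.eval t / β t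

theorem intervalIntegrable_div {β h : ℝ → ℝ} {m l r : ℝ} (hm : 0 < m) (hβ : Measurable β)
    (hlow : ∀ t, m ≤ β t) (hlr : l ≤ r) (hh : ContinuousOn h (Icc l r)) :
    IntervalIntegrable (fun t => h t / β t) MeasureTheory.volume l r := by
  have h1 : IntervalIntegrable h MeasureTheory.volume l r :=
    ContinuousOn.intervalIntegrable (by rwa [uIcc_of_le hlr])
  refine (h1.div_const m).mono_fun ?_ (Filter.Eventually.of_forall fun t => ?_)
  · exact (h1.aestronglyMeasurable_restrict_uIoc.aemeasurable.div
      hβ.aemeasurable).aestronglyMeasurable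
  · have hp : 0 < β t := hm.trans_le (hlow t)
    simp only [norm_div, Real.norm_eq_abs, abs_of_pos hp, abs_of_pos hm]
    exact div_le_div_of_nonneg_left (abs_nonneg _) hm (hlow t)

theorem abs_integral_div_le {β h : ℝ → ℝ} {m l z B : ℝ} (hm : 0 < m)
    (hlow : ∀ t, m ≤ β t) (hlz : l ≤ z) (hh : ∀ t ∈ Icc l z, |h t| ≤ B) :
    |∫ t in l..z, h t / β t| ≤ B / m * (z - l) := by
  have := intervalIntegral.norm_integral_le_of_norm_le_const (a := l) (b := z)
    (f := fun t => h t / β t) (C := B / m) (fun t ht => by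
      rw [uIoc_of_le hlz] at ht
      have hp : 0 < β t := hm.trans_le (hlow t)
      have hB := hh t ⟨ht.1.le, ht.2⟩
      rw [Real.norm_eq_abs, abs_div, abs_of_pos hp]
      exact div_le_div₀ ((abs_nonneg _).trans hB) hB hm (hlow t))
  rwa [Real.norm_eq_abs, abs_of_nonneg (sub_nonneg.2 hlz)] at this

namespace IsGaussRule

variable {p : ℕ} {m M l r : ℝ} {β : ℝ → ℝ} {y A : ℕ → ℝ}

theorem sum_weights_le (G : IsGaussRule p m M β l r y A) :
    ∑ j ∈ Finset.Icc 1 p, A j ≤ (r - l) / m := by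
  have h := G.exact 1 (by simp)
  simp only [Polynomial.eval_one, mul_one] at h
  rw [h]
  refine (le_abs_self _).trans ((abs_integral_div_le (B := 1) G.pos G.lower G.lt.le
    (fun t _ => by simp)).trans (le_of_eq (by ring)))

theorem abs_sum_weights_mul_le (G : IsGaussRule p m M β l r y A) {v : ℕ → ℝ} {B : ℝ}
    (hv : ∀ j ∈ Finset.Icc 1 p, |v j| ≤ B) :
    |∑ j ∈ Finset.Icc 1 p, A j * v j| ≤ (r - l) / m * B := by
  have hB : 0 ≤ B := (abs_nonneg _).trans (hv 1 (Finset.mem_Icc.2 ⟨le_rfl, G.one_le⟩))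
  calc |∑ j ∈ Finset.Icc 1 p, A j * v j| ≤ ∑ j ∈ Finset.Icc 1 p, |A j * v j| :=
        Finset.abs_sum_le_sum_abs _ _
    _ ≤ ∑ j ∈ Finset.Icc 1 p, A j * B := by
        refine Finset.sum_le_sum fun j hj => ?_
        rw [abs_mul, abs_of_pos (G.weight_pos j hj)]
        exact mul_le_mul_of_nonneg_left (hv j hj) (G.weight_pos j hj).le
    _ = (∑ j ∈ Finset.Icc 1 p, A j) * B := by rw [Finset.sum_mul]
    _ ≤ _ := mul_le_mul_of_nonneg_right G.sum_weights_le hB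

/-- Testing a function vanishing at the nodes against a polynomial. -/
theorem abs_integral_mul_le (G : IsGaussRule p m M β l r y A) {f : ℝ → ℝ} {s T : Polynomial ℝ}
    {δ τ : ℝ} (hf : ContinuousOn f (Icc l r)) (hf0 : ∀ j ∈ Finset.Icc 1 p, f (y j) = 0)
    (hs : ∀ t ∈ Icc l r, |f t - s.eval t| ≤ δ) (hT : ∀ t ∈ Icc l r, |T.eval t| ≤ τ)
    (hdeg : s.natDegree + T.natDegree ≤ 2 * p - 1) :
    |∫ t in l..r, f t * T.eval t / β t| ≤ 2 / m * (r - l) * (δ * τ) := by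
  have hl : l ∈ Icc l r := left_mem_Icc.2 G.lt.le
  have hδ : 0 ≤ δ := (abs_nonneg _).trans (hs l hl)
  have h1 : |∫ t in l..r, (f t - s.eval t) * T.eval t / β t| ≤ δ * τ / m * (r - l) :=
    abs_integral_div_le (h := fun t => (f t - s.eval t) * T.eval t) G.pos G.lower G.lt.le
      fun t ht => by
        rw [abs_mul]
        exact mul_le_mul (hs t ht) (hT t ht) (abs_nonneg _) hδ
  have h2 : |∫ t in l..r, (s * T).eval t / β t| ≤ (r - l) / m * (δ * τ) := by
    rw [← G.exact (s * T) (Polynomial.natDegree_mul_le.trans hdeg)]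
    refine G.abs_sum_weights_mul_le fun j hj => ?_
    have hj' : y j ∈ Icc l r := Ioo_subset_Icc_self (G.mem j hj)
    have h3 := hs _ hj'
    rw [hf0 j hj, zero_sub, abs_neg] at h3
    rw [Polynomial.eval_mul, abs_mul]
    exact mul_le_mul h3 (hT _ hj') (abs_nonneg _) hδ
  have h3 : ∫ t in l..r, f t * T.eval t / β t
      = (∫ t in l..r, (f t - s.eval t) * T.eval t / β t) + ∫ t in l..r, (s * T).eval t / β t := by
    rw [← intervalIntegral.integral_add
      (intervalIntegrable_div (h := fun t => (f t - s.eval t) * T.eval t) G.pos G.meas G.lower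
        G.lt.le ((hf.sub s.continuous.continuousOn).mul T.continuous.continuousOn))
      (intervalIntegrable_div G.pos G.meas G.lower G.lt.le (s * T).continuous.continuousOn)]
    refine intervalIntegral.integral_congr fun t _ => ?_
    simp only [Polynomial.eval_mul]
    ring
  rw [h3]
  refine (abs_add_le _ _).trans ((add_le_add h1 h2).trans (le_of_eq ?_))
  ring

/-- A polynomial of degree `p` orthogonal to lower degrees vanishes at the nodes. -/
theorem eval_node_eq_zero (G : IsGaussRule p m M β l r y A) {L : Polynomial ℝ}
    (hL : L.natDegree ≤ p)
    (horth : ∀ q : Polynomial ℝ, q.natDegree < p → ∫ t in l..r, L.eval t * q.eval t / β t = 0)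
    {j : ℕ} (hj : j ∈ Finset.Icc 1 p) : L.eval (y j) = 0 := by
  set ω : Polynomial ℝ :=
    ∏ i ∈ (Finset.Icc 1 p).erase j, (Polynomial.X - Polynomial.C (y i)) with hω
  have hp := G.one_le
  have hdeg : ω.natDegree = p - 1 := by
    rw [hω, Polynomial.natDegree_prod_of_monic _ _ fun i _ => Polynomial.monic_X_sub_C _]
    simp [Finset.card_erase_of_mem hj]
  have h1 := horth ω (by omega)
  have h2 := G.exact (L * ω) (Polynomial.natDegree_mul_le.trans (by omega))
  simp only [Polynomial.eval_mul] at h2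
  rw [h1, Finset.sum_eq_single j] at h2
  · have h3 : ω.eval (y j) ≠ 0 := by
      rw [hω, Polynomial.eval_prod, Finset.prod_ne_zero_iff]
      intro i hi
      rw [Finset.mem_erase] at hi
      simp only [Polynomial.eval_sub, Polynomial.eval_X, Polynomial.eval_C]
      exact sub_ne_zero.2 (G.ne j hj i hi.2 hi.1.symm)
    have h4 := (G.weight_pos j hj).ne'
    simpa [h3, h4] using h2
  · intro i hi hij
    have : ω.eval (y i) = 0 := by
      rw [hω, Polynomial.eval_prod]
      exact Finset.prod_eq_zero (Finset.mem_erase.2 ⟨hij, hi⟩) (by simp)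
    rw [this]
    ring
  · exact fun h => absurd hj h

/-- Polynomials of degree below `p` are bounded by their values at the nodes. -/
theorem exists_abs_eval_le (p : ℕ) (m M : ℝ) : ∃ C : ℝ, 0 < C ∧
    ∀ (β : ℝ → ℝ) (l r : ℝ) (y A : ℕ → ℝ), IsGaussRule p m M β l r y A →
    ∀ (s : Polynomial ℝ) (δ : ℝ), s.natDegree < p →
      (∀ j ∈ Finset.Icc 1 p, |s.eval (y j)| ≤ δ) → ∀ t ∈ Icc l r, |s.eval t| ≤ C * δ := by
  obtain ⟨C₀, hC₀, hC⟩ := exists_sq_eval_le_integral p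
  refine ⟨1 + C₀ * |M / m|, by positivity, fun β l r y A G s δ hs hδ t ht => ?_⟩
  have hδ0 : 0 ≤ δ := (abs_nonneg _).trans (hδ 1 (Finset.mem_Icc.2 ⟨le_rfl, G.one_le⟩))
  have hm := G.pos
  have hM : 0 < M := hm.trans_le ((G.lower 0).trans (G.upper 0))
  have hlr : 0 < r - l := sub_pos.2 G.lt
  rw [abs_of_pos (div_pos hM hm)]
  have h1 : ∫ x in l..r, (s ^ 2).eval x / β x ≤ (r - l) / m * δ ^ 2 := by
    rw [← G.exact (s ^ 2) (Polynomial.natDegree_pow_le.trans (by omega))]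
    refine (le_abs_self _).trans (G.abs_sum_weights_mul_le fun j hj => ?_)
    rw [Polynomial.eval_pow, abs_pow]
    exact pow_le_pow_left₀ (abs_nonneg _) (hδ j hj) 2
  have h2 : (∫ x in l..r, (s.eval x) ^ 2 / M) ≤ ∫ x in l..r, (s ^ 2).eval x / β x := by
    refine intervalIntegral.integral_mono_on G.lt.le
      (Continuous.intervalIntegrable (by fun_prop) _ _)
      (intervalIntegrable_div hm G.meas G.lower G.lt.le (s ^ 2).continuous.continuousOn)
      fun x _ => ?_
    rw [Polynomial.eval_pow]
    exact div_le_div_of_nonneg_left (sq_nonneg _) (hm.trans_le (G.lower x)) (G.upper x)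
  set s' : Polynomial ℝ := s.comp (Polynomial.C l + Polynomial.C (r - l) * Polynomial.X) with hs'
  have hs'e : ∀ x, s'.eval x = s.eval (l + (r - l) * x) := fun x => by simp [hs']
  have hs'd : s'.natDegree < p := by
    have h3 : (Polynomial.C l + Polynomial.C (r - l) * Polynomial.X : Polynomial ℝ).natDegree
        ≤ 1 := by
      refine Polynomial.natDegree_add_le_of_degree_le (by simp) ?_
      exact (Polynomial.natDegree_C_mul_le _ _).trans Polynomial.natDegree_X_le
    refine lt_of_le_of_lt (Polynomial.natDegree_comp_le.trans ?_) hs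
    exact (Nat.mul_le_mul_left _ h3).trans (by simp)
  have h4 := hC s' hs'd ((t - l) / (r - l))
    ⟨div_nonneg (by linarith [ht.1]) hlr.le, (div_le_one hlr).2 (by linarith [ht.2])⟩
  have h5 : l + (r - l) * ((t - l) / (r - l)) = t := by field_simp; ring
  simp only [hs'e] at h4
  rw [h5, intervalIntegral.integral_comp_add_mul (fun x => (s.eval x) ^ 2) hlr.ne'] at h4
  simp only [mul_zero, add_zero, mul_one, add_sub_cancel, smul_eq_mul] at h4
  rw [intervalIntegral.integral_div] at h2
  have h6 : ∫ x in l..r, (s.eval x) ^ 2 ≤ (r - l) / m * δ ^ 2 * M :=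
    (div_le_iff₀ hM).1 (h2.trans h1)
  have h7 : (s.eval t) ^ 2 ≤ C₀ * (M / m) * δ ^ 2 := by
    refine h4.trans ?_
    calc C₀ * ((r - l)⁻¹ * ∫ x in l..r, (s.eval x) ^ 2)
        ≤ C₀ * ((r - l)⁻¹ * ((r - l) / m * δ ^ 2 * M)) := by gcongr
      _ = _ := by field_simp
  refine abs_le_of_sq_le_sq (h7.trans ?_) (by positivity)
  have h8 : 0 ≤ C₀ * (M / m) := by positivity
  rw [mul_pow]
  exact mul_le_mul_of_nonneg_right (by nlinarith) (sq_nonneg _)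

/-- Integrals up to a generalized Lobatto point of a function that vanishes at the nodes and is
close to a polynomial of degree `p`. -/
theorem abs_integral_lobatto_le {C : ℝ} (hC : 0 < C) (G : IsGaussRule p m M β l r y A)
    (hbd : ∀ (s : Polynomial ℝ) (δ : ℝ), s.natDegree < p →
      (∀ j ∈ Finset.Icc 1 p, |s.eval (y j)| ≤ δ) → ∀ t ∈ Icc l r, |s.eval t| ≤ C * δ)
    {L s : Polynomial ℝ} (hL : L.degree = (p : WithBot ℕ))
    (horth : ∀ q : Polynomial ℝ, q.natDegree < p → ∫ t in l..r, L.eval t * q.eval t / β t = 0)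
    {f : ℝ → ℝ} {δ z : ℝ} (hf : ContinuousOn f (Icc l r))
    (hf0 : ∀ j ∈ Finset.Icc 1 p, f (y j) = 0) (hs : ∀ t ∈ Icc l r, |f t - s.eval t| ≤ δ)
    (hsd : s.natDegree ≤ p) (hz : z ∈ Icc l r) (hLz : ∫ t in l..z, L.eval t / β t = 0) :
    |∫ t in l..z, f t / β t| ≤ (1 + C) * δ / m * (r - l) := by
  have hp := G.one_le
  have hδ : 0 ≤ δ := (abs_nonneg _).trans (hs z hz)
  have hLn : L.natDegree = p := Polynomial.natDegree_eq_of_degree_eq_some hL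
  have hL0 : L.coeff p ≠ 0 := Polynomial.coeff_ne_zero_of_eq_degree hL
  set k := s.coeff p / L.coeff p with hk
  set s₁ := s - Polynomial.C k * L with hs₁
  have hs₁d : s₁.natDegree < p := by
    have h1 : s₁.natDegree ≤ p := (Polynomial.natDegree_sub_le_of_le hsd
      ((Polynomial.natDegree_C_mul_le k L).trans hLn.le)).trans (max_self p).le
    have h2 : s₁.coeff p = 0 := by
      rw [hs₁, Polynomial.coeff_sub, Polynomial.coeff_C_mul, hk, div_mul_cancel₀ _ hL0, sub_self]
    refine lt_of_le_of_ne h1 fun h => ?_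
    have h3 : s₁.leadingCoeff = 0 := by rw [Polynomial.leadingCoeff, h, h2]
    rw [Polynomial.leadingCoeff_eq_zero] at h3
    rw [h3, Polynomial.natDegree_zero] at h
    omega
  have hs₁e : ∀ t, s₁.eval t = s.eval t - k * L.eval t := fun t => by simp [hs₁]
  have hs₁b := hbd s₁ δ hs₁d fun j hj => by
    have h3 := hs _ (Ioo_subset_Icc_self (G.mem j hj))
    rw [hf0 j hj, zero_sub, abs_neg] at h3
    rwa [hs₁e, G.eval_node_eq_zero hLn.le horth hj, mul_zero, sub_zero]
  have hsub : Icc l z ⊆ Icc l r := Icc_subset_Icc_right hz.2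
  have h1 : |∫ t in l..z, (f t - k * L.eval t) / β t| ≤ (1 + C) * δ / m * (z - l) :=
    abs_integral_div_le (h := fun t => f t - k * L.eval t) G.pos G.lower hz.1 fun t ht => by
      have e : f t - k * L.eval t = (f t - s.eval t) + s₁.eval t := by rw [hs₁e]; ring
      rw [e]
      exact (abs_add_le _ _).trans
        ((add_le_add (hs t (hsub ht)) (hs₁b t (hsub ht))).trans_eq (by ring))
  have h2 : ∫ t in l..z, f t / β t = ∫ t in l..z, (f t - k * L.eval t) / β t := by
    have h3 : ∫ t in l..z, (f t - k * L.eval t) / β t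
        = (∫ t in l..z, f t / β t) - ∫ t in l..z, k * (L.eval t / β t) := by
      rw [← intervalIntegral.integral_sub
        (intervalIntegrable_div G.pos G.meas G.lower hz.1 (hf.mono hsub))
        ((intervalIntegrable_div G.pos G.meas G.lower hz.1
          L.continuous.continuousOn).const_mul k)]
      refine intervalIntegral.integral_congr fun t _ => ?_
      ring
    rw [h3, intervalIntegral.integral_const_mul, hLz, mul_zero, sub_zero]
  rw [h2]
  refine h1.trans ?_
  have := G.pos
  exact mul_le_mul_of_nonneg_left (by linarith [hz.2]) (by positivity)

end IsGaussRule

/-- Energy estimate for the first order system `βy' = γy + H + σ₁`, `H' = c(y + σ₂)` with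
homogeneous boundary values. -/
theorem exists_energy_bound (m M γ c d : ℝ) (hm : 0 < m) (hc : 0 < c) (hd : 0 < d) :
    ∃ C : ℝ, 0 < C ∧ ∀ (a b α ε : ℝ) (β y H σ₁ σ₂ : ℝ → ℝ), b - a = d →
      (∀ t, m ≤ β t) → (∀ t, β t ≤ M) →
      ContinuousOn y (Icc a b) → ContinuousOn H (Icc a b) →
      (∀ t ∈ Ioo a b, t ≠ α → HasDerivAt y ((γ * y t + H t + σ₁ t) / β t) t) →
      (∀ t ∈ Ioo a b, t ≠ α → HasDerivAt H (c * (y t + σ₂ t)) t) →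
      (∀ t ∈ Icc a b, |σ₁ t| ≤ ε) → (∀ t ∈ Icc a b, |σ₂ t| ≤ ε) → y a = 0 → y b = 0 →
      ∀ t ∈ Icc a b, |y t| ≤ C * ε ∧ |H t| ≤ C * ε := by
  set μ := min m c / 2 with hμ
  have hμ0 : 0 < μ := by have := lt_min hm hc; positivity
  have hμm : μ ≤ m / 2 := by have := min_le_left m c; linarith
  have hμc : μ ≤ c / 2 := by have := min_le_right m c; linarith
  set K := 1 / (2 * m) + c / 2 with hK
  have hK0 : 0 < K := by positivity
  set C₁ := 1 + K * d / (2 * μ) with hC₁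
  have hC₁1 : 1 ≤ C₁ := by have : 0 < K * d / (2 * μ) := by positivity
                           linarith
  set C₂ := |γ| * C₁ + 1 + c * (C₁ + 1) * d with hC₂
  have hC₂0 : 0 < C₂ := by positivity
  refine ⟨C₁ + C₂, by positivity, ?_⟩
  intro a b α ε β y H σ₁ σ₂ hab hlow hup hyc hHc hy hH hσ₁ hσ₂ hya hyb
  have hab' : a < b := by linarith
  have hε : 0 ≤ ε := (abs_nonneg _).trans (hσ₁ a (left_mem_Icc.2 hab'.le))
  have hβ0 : ∀ t, 0 < β t := fun t => hm.trans_le (hlow t)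
  set y' : ℝ → ℝ := fun t => (γ * y t + H t + σ₁ t) / β t with hy'
  have hβy' : ∀ t, β t * y' t = γ * y t + H t + σ₁ t := fun t => by
    simp only [hy']
    field_simp [(hβ0 t).ne']
  set Z : ℝ → ℝ := fun t => y t * H t + γ * y t ^ 2 / 2 with hZ
  have hZ' : ∀ t ∈ Ioo a b, t ≠ α → HasDerivAt Z
      (β t * y' t ^ 2 + c * y t ^ 2 - σ₁ t * y' t + c * σ₂ t * y t) t := by
    intro t ht hne
    have h1 := hy t ht hne
    have h2 := (h1.mul (hH t ht hne)).add (((h1.pow 2).const_mul γ).div_const 2)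
    refine h2.congr_deriv ?_
    have h3 := hβy' t
    have h4 : H t = β t * y' t - γ * y t - σ₁ t := by linarith
    change y' t * H t + y t * (c * (y t + σ₂ t)) + γ * (↑2 * y t ^ (2 - 1) * y' t) / 2 = _
    rw [h4]
    push_cast
    ring
  have hlowZ : ∀ t ∈ Icc a b, ∀ σ : ℝ, σ = 1 ∨ σ = -1 →
      0 ≤ (β t * y' t ^ 2 + c * y t ^ 2 - σ₁ t * y' t + c * σ₂ t * y t)
        + σ * (μ * (2 * y t * y' t)) + K * ε ^ 2 := by
    intro t ht σ hσ
    have h1 : m * y' t ^ 2 ≤ β t * y' t ^ 2 :=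
      mul_le_mul_of_nonneg_right (hlow t) (sq_nonneg _)
    have hs1 : σ₁ t ^ 2 ≤ ε ^ 2 := by
      rw [← sq_abs]; exact pow_le_pow_left₀ (abs_nonneg _) (hσ₁ t ht) 2
    have hs2 : σ₂ t ^ 2 ≤ ε ^ 2 := by
      rw [← sq_abs]; exact pow_le_pow_left₀ (abs_nonneg _) (hσ₂ t ht) 2
    have h2 : σ₁ t * y' t ≤ m / 2 * y' t ^ 2 + 1 / (2 * m) * ε ^ 2 := by
      have h3 : m / 2 * y' t ^ 2 + 1 / (2 * m) * σ₁ t ^ 2 - σ₁ t * y' t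
          = 1 / (2 * m) * (m * y' t - σ₁ t) ^ 2 := by field_simp; ring
      have h4 : 0 ≤ 1 / (2 * m) * (m * y' t - σ₁ t) ^ 2 := by positivity
      have h5 : 1 / (2 * m) * σ₁ t ^ 2 ≤ 1 / (2 * m) * ε ^ 2 := by gcongr
      linarith
    have h6 : -(c * σ₂ t * y t) ≤ c / 2 * y t ^ 2 + c / 2 * ε ^ 2 := by
      nlinarith [sq_nonneg (y t + σ₂ t)]
    have h7 : 0 ≤ μ * (y t + σ * y' t) ^ 2 := by positivity
    have h8 : μ * y' t ^ 2 ≤ m / 2 * y' t ^ 2 := mul_le_mul_of_nonneg_right hμm (sq_nonneg _)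
    have h9 : μ * y t ^ 2 ≤ c / 2 * y t ^ 2 := mul_le_mul_of_nonneg_right hμc (sq_nonneg _)
    have hσ2 : σ ^ 2 = 1 := by rcases hσ with rfl | rfl <;> norm_num
    have h10 : μ * (y t + σ * y' t) ^ 2
        = μ * y t ^ 2 + σ * (μ * (2 * y t * y' t)) + σ ^ 2 * (μ * y' t ^ 2) := by ring
    rw [hσ2] at h10
    have h11 : K * ε ^ 2 = 1 / (2 * m) * ε ^ 2 + c / 2 * ε ^ 2 := by rw [hK]; ring
    linarith
  have hmono : ∀ σ : ℝ, σ = 1 ∨ σ = -1 → ∀ l r, a ≤ l → l ≤ r → r ≤ b →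
      Z l + σ * (μ * y l ^ 2) + K * ε ^ 2 * l ≤ Z r + σ * (μ * y r ^ 2) + K * ε ^ 2 * r := by
    intro σ hσ l r hl hlr hr
    have hsub : Icc l r ⊆ Icc a b := Icc_subset_Icc hl hr
    have hy1 := hyc.mono hsub
    have hH1 := hHc.mono hsub
    refine le_of_hasDerivAt_nonneg_off
      (f := fun t => Z t + σ * (μ * y t ^ 2) + K * ε ^ 2 * t)
      (f' := fun t => (β t * y' t ^ 2 + c * y t ^ 2 - σ₁ t * y' t + c * σ₂ t * y t)
        + σ * (μ * (2 * y t * y' t)) + K * ε ^ 2) (α := α) hlr (by simp only [hZ]; fun_prop) ?_ ?_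
    · intro t ht hne
      have ht' : t ∈ Ioo a b := ⟨hl.trans_lt ht.1, ht.2.trans_le hr⟩
      have h1 := ((hZ' t ht' hne).add ((((hy t ht' hne).pow 2).const_mul μ).const_mul σ)).add
        ((hasDerivAt_id t).const_mul (K * ε ^ 2))
      refine h1.congr_deriv ?_
      simp only [hy']
      push_cast
      ring
    · exact fun t ht _ => hlowZ t (hsub (Ioo_subset_Icc_self ht)) σ hσ
  have hyb1 : ∀ t ∈ Icc a b, |y t| ≤ C₁ * ε := by
    intro t ht
    have h1 := hmono (-1) (Or.inr rfl) a t le_rfl ht.1 ht.2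
    have h2 := hmono 1 (Or.inl rfl) t b ht.1 ht.2 le_rfl
    simp only [hZ, hya, hyb] at h1 h2
    have h3 : 2 * μ * y t ^ 2 ≤ K * ε ^ 2 * d := by rw [← hab]; linarith
    have h4 : y t ^ 2 ≤ K * d / (2 * μ) * ε ^ 2 := by
      have h5 : K * d / (2 * μ) * ε ^ 2 = K * ε ^ 2 * d / (2 * μ) := by ring
      rw [h5, le_div_iff₀ (by positivity)]
      linarith
    refine abs_le_of_sq_le_sq (h4.trans ?_) (by positivity)
    rw [mul_pow]
    refine mul_le_mul_of_nonneg_right ?_ (sq_nonneg _)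
    have : 0 < K * d / (2 * μ) := by positivity
    rw [hC₁]
    nlinarith
  have hHdiff : ∀ s ∈ Icc a b, ∀ t ∈ Icc a b, |H s - H t| ≤ c * (C₁ + 1) * d * ε := by
    have key : ∀ l r, a ≤ l → l ≤ r → r ≤ b → |H r - H l| ≤ c * (C₁ + 1) * d * ε := by
      intro l r hl hlr hr
      have hsub : Icc l r ⊆ Icc a b := Icc_subset_Icc hl hr
      refine (abs_sub_le_of_hasDerivAt_off (B := c * ((C₁ + 1) * ε)) hlr (hHc.mono hsub)
        (fun t ht hne => hH t ⟨hl.trans_lt ht.1, ht.2.trans_le hr⟩ hne) ?_).trans ?_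
      · intro t ht _
        have ht' := hsub (Ioo_subset_Icc_self ht)
        rw [abs_mul, abs_of_pos hc]
        refine mul_le_mul_of_nonneg_left ((abs_add_le _ _).trans ?_) hc.le
        linarith [hyb1 t ht', hσ₂ t ht']
      · have h1 : r - l ≤ d := by linarith
        calc c * ((C₁ + 1) * ε) * (r - l) ≤ c * ((C₁ + 1) * ε) * d := by gcongr
          _ = _ := by ring
    intro s hs t ht
    rcases le_total s t with h | h
    · rw [abs_sub_comm]; exact key s t hs.1 h ht.2
    · exact key t s ht.1 h hs.2
  have hM : 0 < M := (hβ0 0).trans_le (hup 0)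
  have hone : ∀ σ : ℝ, σ = 1 ∨ σ = -1 → ∀ t ∈ Icc a b, σ * H t ≤ C₂ * ε := by
    intro σ hσ t ht
    by_contra! hcon
    set η := σ * H t - C₂ * ε with hη
    have hη0 : 0 < η := by linarith
    have hσabs : ∀ z, σ * z ≤ |z| := fun z => by
      rcases hσ with rfl | rfl
      · simpa using le_abs_self z
      · simpa using neg_le_abs z
    have h1 : σ * y a - η / M * a ≤ σ * y b - η / M * b := by
      refine le_of_hasDerivAt_nonneg_off (f := fun s => σ * y s - η / M * s)
        (f' := fun s => σ * y' s - η / M * 1) (α := α) hab'.le (by fun_prop)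
        (fun s hs hne => ((hy s hs hne).const_mul σ).sub ((hasDerivAt_id s).const_mul (η / M)))
        fun s hs _ => ?_
      have hs' := Ioo_subset_Icc_self hs
      have h2 : σ * (H t - H s) ≤ c * (C₁ + 1) * d * ε :=
        (hσabs _).trans (hHdiff t ht s hs')
      have h3 : σ * (-(γ * y s)) ≤ |γ| * (C₁ * ε) := by
        refine (hσabs _).trans ?_
        rw [abs_neg, abs_mul]
        exact mul_le_mul_of_nonneg_left (hyb1 s hs') (abs_nonneg _)
      have h4 : σ * (-(σ₁ s)) ≤ ε := (hσabs _).trans (by rw [abs_neg]; exact hσ₁ s hs')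
      have h5 : η ≤ σ * (γ * y s + H s + σ₁ s) := by
        rw [hη, hC₂]
        linarith
      have h6 : σ * y' s = σ * (γ * y s + H s + σ₁ s) / β s := by simp only [hy']; ring
      rw [h6, mul_one, sub_nonneg]
      exact div_le_div₀ (hη0.le.trans h5) h5 (hβ0 s) (hup s)
    rw [hya, hyb] at h1
    have h7 : 0 < η / M := by positivity
    nlinarith
  intro t ht
  constructor
  · refine (hyb1 t ht).trans ?_
    gcongr
    linarith
  · have h1 := hone 1 (Or.inl rfl) t ht
    have h2 := hone (-1) (Or.inr rfl) t ht
    have h3 : C₂ * ε ≤ (C₁ + C₂) * ε := by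
      gcongr
      linarith
    rw [abs_le]
    constructor <;> linarith

theorem betaPW_lower (βm βp α t : ℝ) : min βm βp ≤ betaPW βm βp α t := by
  unfold betaPW
  split_ifs
  exacts [min_le_left _ _, min_le_right _ _]

theorem betaPW_upper (βm βp α t : ℝ) : betaPW βm βp α t ≤ max βm βp := by
  unfold betaPW
  split_ifs
  exacts [le_max_left _ _, le_max_right _ _]

theorem measurable_betaPW (βm βp α : ℝ) : Measurable (betaPW βm βp α) :=
  Measurable.ite measurableSet_Iio measurable_const measurable_const

/-- The primitive of `S'/β` for the piecewise constant coefficient `β`. -/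
noncomputable def weightedPrimitive (βm βp α : ℝ) (S : ℝ → ℝ) (x : ℝ) : ℝ :=
  S (min x α) / βm + (S (max x α) - S α) / βp

theorem continuous_weightedPrimitive (βm βp α : ℝ) {S : ℝ → ℝ} (hS : Continuous S) :
    Continuous (weightedPrimitive βm βp α S) := by
  unfold weightedPrimitive
  fun_prop

theorem hasDerivAt_weightedPrimitive (βm βp : ℝ) {α t S' : ℝ} {S : ℝ → ℝ} (ht : t ≠ α)
    (hS : HasDerivAt S S' t) :
    HasDerivAt (weightedPrimitive βm βp α S) (S' / betaPW βm βp α t) t := by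
  rcases lt_or_gt_of_ne ht with h | h
  · rw [betaPW, if_pos h]
    refine ((hS.div_const βm).add_const ((S α - S α) / βp)).congr_of_eventuallyEq ?_
    filter_upwards [Iio_mem_nhds h] with x hx
    rw [weightedPrimitive, min_eq_left (le_of_lt hx), max_eq_right (le_of_lt hx)]
  · rw [betaPW, if_neg h.not_gt]
    refine (((hS.sub_const (S α)).div_const βp).const_add (S α / βm)).congr_of_eventuallyEq ?_
    filter_upwards [Ioi_mem_nhds h] with x hx
    rw [weightedPrimitive, min_eq_right (le_of_lt hx), max_eq_left (le_of_lt hx)]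

theorem abs_weightedPrimitive_le {βm βp a b α B : ℝ} {S : ℝ → ℝ} (hβm : 0 < βm) (hβp : 0 < βp)
    (hα : α ∈ Icc a b) (hS : ∀ x ∈ Icc a b, |S x| ≤ B) {x : ℝ} (hx : x ∈ Icc a b) :
    |weightedPrimitive βm βp α S x| ≤ 3 / min βm βp * B := by
  have hm : 0 < min βm βp := lt_min hβm hβp
  have h1 : |S (min x α)| ≤ B := hS _ ⟨le_min hx.1 hα.1, (min_le_left _ _).trans hx.2⟩
  have h2 : |S (max x α)| ≤ B := hS _ ⟨hx.1.trans (le_max_left _ _), max_le hx.2 hα.2⟩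
  have hB : 0 ≤ B := (abs_nonneg _).trans h1
  have h3 : |S (max x α) - S α| ≤ 2 * B := (abs_sub _ _).trans (by linarith [hS α hα])
  unfold weightedPrimitive
  refine (abs_add_le _ _).trans ?_
  rw [abs_div, abs_div, abs_of_pos hβm, abs_of_pos hβp]
  have h4 := div_le_div₀ hB h1 hm (min_le_left βm βp)
  have h5 := div_le_div₀ (by positivity) h3 hm (min_le_right βm βp)
  refine (add_le_add h4 h5).trans (le_of_eq (by ring))

theorem hasDerivAt_integral_right {h : ℝ → ℝ} (hh : Continuous h) (a t : ℝ) :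
    HasDerivAt (fun x => ∫ s in a..x, h s) (h t) t :=
  (hh.integral_hasStrictDerivAt a t).hasDerivAt

/-- Stability of the reduced two-point boundary value problem: the solution follows the
perturbation `ρ` up to the size of its boundary value and of its primitive. -/
theorem exists_stability_bound (βm βp γ c d : ℝ) (hβm : 0 < βm) (hβp : 0 < βp) (hc : 0 < c)
    (hd : 0 < d) : ∃ C : ℝ, 0 < C ∧ ∀ (a b α K ε : ℝ) (e ρ : ℝ → ℝ), b - a = d →
      a < α → α < b → Continuous e → Continuous ρ →
      (∀ x, e x = ρ x + weightedPrimitive βm βp α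
        (fun x => ∫ t in a..x, (γ * e t + c * (∫ s in a..t, e s) + K)) x) →
      e a = 0 → e b = 0 → |ρ b| ≤ ε → (∀ x ∈ Icc a b, |∫ t in a..x, ρ t| ≤ ε) →
      |K| ≤ C * ε ∧ ∀ x ∈ Icc a b, |e x - ρ x| ≤ C * ε := by
  set m := min βm βp with hm
  set M := max βm βp with hM
  have hm0 : 0 < m := lt_min hβm hβp
  have hM0 : 0 < M := hβm.trans_le (le_max_left _ _)
  obtain ⟨C₀, hC₀, hC⟩ := exists_energy_bound m M γ c d hm0 hc hd
  set p₁ := 3 / m with hp₁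
  set b₁ := 3 / m * d with hb₁
  set t₁ := (1 + |γ| * p₁) * (M / d) with ht₁
  set q₁ := γ ^ 2 * p₁ + c + t₁ * (|γ| * b₁ + 1) + (|γ| * p₁ + t₁ * b₁) with hq₁
  have hp₁0 : 0 < p₁ := by positivity
  have hb₁0 : 0 < b₁ := by positivity
  have ht₁0 : 0 < t₁ := by positivity
  have hq₁0 : 0 < q₁ := by positivity
  refine ⟨C₀ * q₁ + t₁ * b₁ + |γ| * p₁, by positivity, ?_⟩
  intro a b α K ε e ρ hab haα hαb hec hρc heq hea heb hρb hR
  have hab' : a < b := haα.trans hαb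
  have hα : α ∈ Icc a b := ⟨haα.le, hαb.le⟩
  have hb : b ∈ Icc a b := right_mem_Icc.2 hab'.le
  have ha : a ∈ Icc a b := left_mem_Icc.2 hab'.le
  have hε : 0 ≤ ε := (abs_nonneg _).trans hρb
  set J : ℝ → ℝ := fun x => ∫ s in a..x, e s with hJ
  set R : ℝ → ℝ := fun x => ∫ s in a..x, ρ s with hRdef
  have hJd : ∀ t, HasDerivAt J (e t) t := hasDerivAt_integral_right hec a
  have hRd : ∀ t, HasDerivAt R (ρ t) t := hasDerivAt_integral_right hρc a
  have hJc : Continuous J := continuous_iff_continuousAt.2 fun t => (hJd t).continuousAt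
  have hRc : Continuous R := continuous_iff_continuousAt.2 fun t => (hRd t).continuousAt
  set g : ℝ → ℝ := fun t => γ * e t + c * J t + K with hg
  have hgc : Continuous g := by simp only [hg]; fun_prop
  set Γ : ℝ → ℝ := weightedPrimitive βm βp α (fun x => ∫ t in a..x, g t) with hΓ
  have hΓc : Continuous Γ := continuous_weightedPrimitive _ _ _
    (continuous_iff_continuousAt.2 fun t => (hasDerivAt_integral_right hgc a t).continuousAt)
  have hΓd : ∀ t, t ≠ α → HasDerivAt Γ (g t / betaPW βm βp α t) t := fun t ht =>
    hasDerivAt_weightedPrimitive βm βp ht (hasDerivAt_integral_right hgc a t)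
  set P : ℝ → ℝ := weightedPrimitive βm βp α R with hP
  have hPc : Continuous P := continuous_weightedPrimitive _ _ _ hRc
  have hPd : ∀ t, t ≠ α → HasDerivAt P (ρ t / betaPW βm βp α t) t := fun t ht =>
    hasDerivAt_weightedPrimitive βm βp ht (hRd t)
  have hPb : ∀ x ∈ Icc a b, |P x| ≤ p₁ * ε := fun x hx =>
    abs_weightedPrimitive_le hβm hβp hα hR hx
  set W : ℝ → ℝ := weightedPrimitive βm βp α (fun x => x - a) with hW
  have hWc : Continuous W := continuous_weightedPrimitive _ _ _ (by fun_prop)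
  have hWd : ∀ t, t ≠ α → HasDerivAt W (1 / betaPW βm βp α t) t := fun t ht =>
    hasDerivAt_weightedPrimitive βm βp ht ((hasDerivAt_id t).sub_const a)
  have hWb : ∀ x ∈ Icc a b, |W x| ≤ b₁ := fun x hx =>
    abs_weightedPrimitive_le hβm hβp hα
      (fun z hz => abs_le.2 ⟨by linarith [hz.1], by linarith [hz.2]⟩) hx
  have hWend : d / M ≤ W b := by
    simp only [hW, weightedPrimitive, min_eq_right hαb.le, max_eq_left hαb.le]
    have h1 : (α - a) / M ≤ (α - a) / βm :=
      div_le_div_of_nonneg_left (by linarith) hβm (le_max_left _ _)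
    have h2 : (b - α) / M ≤ (b - a - (α - a)) / βp := by
      rw [sub_sub_sub_cancel_right]
      exact div_le_div_of_nonneg_left (by linarith) hβp (le_max_right _ _)
    have h3 : d / M = (α - a) / M + (b - α) / M := by rw [← hab]; ring
    linarith
  have hdM : 0 < d / M := by positivity
  have hWb0 : 0 < W b := hdM.trans_le hWend
  have hzero : ∀ S : ℝ → ℝ, S a = 0 → weightedPrimitive βm βp α S a = 0 := fun S hS => by
    simp [weightedPrimitive, min_eq_left haα.le, max_eq_right haα.le, hS]
  have hWa : W a = 0 := hzero _ (sub_self a)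
  have hPa : P a = 0 := hzero _ intervalIntegral.integral_same
  have hΓa : Γ a = 0 := hzero _ intervalIntegral.integral_same
  set τ := (Γ b - γ * P b) / W b with hτ
  have hτb : |τ| ≤ t₁ * ε := by
    have h1 : Γ b - γ * P b = -ρ b - γ * P b := by
      have := heq b
      rw [heb] at this
      linarith
    rw [hτ, h1, abs_div, abs_of_pos hWb0, div_le_iff₀ hWb0]
    have h2 : |-ρ b - γ * P b| ≤ (1 + |γ| * p₁) * ε := by
      refine (abs_sub _ _).trans ?_
      rw [abs_neg, abs_mul]
      have := mul_le_mul_of_nonneg_left (hPb b hb) (abs_nonneg γ)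
      linarith
    refine h2.trans ?_
    have h3 : t₁ * ε * (d / M) ≤ t₁ * ε * W b := by gcongr
    refine le_trans (le_of_eq ?_) h3
    rw [ht₁]
    field_simp
  set y : ℝ → ℝ := fun t => Γ t - γ * P t - τ * W t with hy
  set H : ℝ → ℝ := fun t => K + c * J t - c * R t with hH
  have hres := hC a b α (q₁ * ε) (betaPW βm βp α) y H
    (fun t => γ ^ 2 * P t + c * R t + τ * (γ * W t - 1)) (fun t => γ * P t + τ * W t) hab
    (betaPW_lower βm βp α) (betaPW_upper βm βp α) (by fun_prop) (by fun_prop)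
    (fun t _ hne => by
      refine (((hΓd t hne).sub ((hPd t hne).const_mul γ)).sub
        ((hWd t hne).const_mul τ)).congr_deriv ?_
      have h1 : e t = ρ t + Γ t := heq t
      simp only [hg, hy, hH, h1]
      ring)
    (fun t _ _ => by
      refine ((((hJd t).const_mul c).const_add K).sub ((hRd t).const_mul c)).congr_deriv ?_
      have h1 : e t = ρ t + Γ t := heq t
      simp only [hy, h1]
      ring)
    (fun t ht => by
      have h1 : |γ ^ 2 * P t| ≤ γ ^ 2 * (p₁ * ε) := by
        rw [abs_mul, abs_of_nonneg (sq_nonneg γ)]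
        exact mul_le_mul_of_nonneg_left (hPb t ht) (sq_nonneg _)
      have h2 : |c * R t| ≤ c * ε := by
        rw [abs_mul, abs_of_pos hc]
        exact mul_le_mul_of_nonneg_left (hR t ht) hc.le
      have h3 : |τ * (γ * W t - 1)| ≤ t₁ * ε * (|γ| * b₁ + 1) := by
        rw [abs_mul]
        refine mul_le_mul hτb ((abs_sub _ _).trans ?_) (abs_nonneg _) (by positivity)
        rw [abs_mul, abs_one]
        have := mul_le_mul_of_nonneg_left (hWb t ht) (abs_nonneg γ)
        linarith
      have h4 : 0 ≤ (|γ| * p₁ + t₁ * b₁) * ε := by positivity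
      refine (abs_add_three _ _ _).trans ?_
      rw [hq₁]
      linarith)
    (fun t ht => by
      have h1 : |γ * P t| ≤ |γ| * (p₁ * ε) := by
        rw [abs_mul]
        exact mul_le_mul_of_nonneg_left (hPb t ht) (abs_nonneg _)
      have h3 : |τ * W t| ≤ t₁ * ε * b₁ := by
        rw [abs_mul]
        exact mul_le_mul hτb (hWb t ht) (abs_nonneg _) (by positivity)
      have h4 : 0 ≤ (γ ^ 2 * p₁ + c + t₁ * (|γ| * b₁ + 1)) * ε := by positivity
      refine (abs_add_le _ _).trans ?_
      rw [hq₁]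
      linarith)
    (by simp only [hy, hΓa, hPa, hWa]; ring)
    (by
      simp only [hy, hτ]
      field_simp
      ring)
  have hext : 0 ≤ (t₁ * b₁ + |γ| * p₁) * ε := by positivity
  refine ⟨?_, fun x hx => ?_⟩
  · have h1 := (hres a ha).2
    have h2 : H a = K := by simp [hH, hJ, hRdef]
    rw [h2] at h1
    linarith
  · have h1 := (hres x hx).1
    have h2 : e x - ρ x = y x + τ * W x + γ * P x := by
      have h3 : e x = ρ x + Γ x := heq x
      rw [h3]
      simp only [hy]
      ring
    rw [h2]
    have h4 : |γ * P x| ≤ |γ| * (p₁ * ε) := by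
      rw [abs_mul]
      exact mul_le_mul_of_nonneg_left (hPb x hx) (abs_nonneg _)
    have h5 : |τ * W x| ≤ t₁ * ε * b₁ := by
      rw [abs_mul]
      exact mul_le_mul hτb (hWb x hx) (abs_nonneg _) (by positivity)
    refine (abs_add_three _ _ _).trans ?_
    linarith

section Mesh

variable {N : ℕ} {x : ℕ → ℝ}

theorem mesh_mono (hx : ∀ i, i < N → x i < x (i + 1)) {i j : ℕ} (hij : i ≤ j) (hj : j ≤ N) :
    x i ≤ x j := by
  induction j, hij using Nat.le_induction with
  | base => exact le_rfl
  | succ j _ ih => exact (ih (by omega)).trans (hx j (by omega)).le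

theorem exists_mem_element (hx : ∀ i, i < N → x i < x (i + 1)) (hN : 1 ≤ N) {t : ℝ}
    (ht : t ∈ Icc (x 0) (x N)) : ∃ i ∈ Finset.Icc 1 N, t ∈ Icc (x (i - 1)) (x i) := by
  induction N, hN using Nat.le_induction with
  | base => exact ⟨1, by simp, ht⟩
  | succ n hn ih =>
    rcases le_total t (x n) with h | h
    · obtain ⟨i, hi, hit⟩ := ih (fun i hi => hx i (by omega)) ⟨ht.1, h⟩
      rw [Finset.mem_Icc] at hi
      exact ⟨i, Finset.mem_Icc.2 ⟨hi.1, by omega⟩, hit⟩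
    · exact ⟨n + 1, by simp, h, ht.2⟩

/-- Increments bounded elementwise, up to one exceptional element, are bounded globally. -/
theorem abs_sub_le_of_increments (k : ℕ) {φ : ℝ → ℝ} {B B' : ℝ} (hB' : 0 ≤ B')
    (h : ∀ i ∈ Finset.Icc 1 N,
      |φ (x i) - φ (x (i - 1))| ≤ B * (x i - x (i - 1)) + if i = k then B' else 0)
    {n : ℕ} (hn : n ≤ N) : |φ (x n) - φ (x 0)| ≤ B * (x n - x 0) + B' := by
  have key : ∀ n ≤ N, |φ (x n) - φ (x 0)| ≤ B * (x n - x 0)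
      + if k ∈ Finset.Icc 1 n then B' else 0 := by
    intro n
    induction n with
    | zero => simp
    | succ n ih =>
      intro hn
      have h1 := ih (by omega)
      have h2 := h (n + 1) (Finset.mem_Icc.2 ⟨by omega, hn⟩)
      rw [Nat.add_sub_cancel] at h2
      have h3 := abs_add_le (φ (x (n + 1)) - φ (x n)) (φ (x n) - φ (x 0))
      rw [sub_add_sub_cancel] at h3
      have h4 : (if n + 1 = k then B' else 0) + (if k ∈ Finset.Icc 1 n then B' else 0)
          ≤ if k ∈ Finset.Icc 1 (n + 1) then B' else 0 := by
        simp only [Finset.mem_Icc]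
        split_ifs <;> first | linarith | omega
      linarith
  refine (key n hn).trans ?_
  split_ifs <;> linarith

end Mesh

/-- Away from the interface element the diffusion coefficient is constant. -/
theorem betaPW_eq_on_element {N k : ℕ} {x : ℕ → ℝ} {βm βp α : ℝ} (hβm : 0 < βm) (hβp : 0 < βp)
    (hx : ∀ i, i < N → x i < x (i + 1)) (hkN : k ≤ N) (hl : x (k - 1) < α)
    (hr : α < x k) {i : ℕ} (hi : i ∈ Finset.Icc 1 N) (hik : i ≠ k) :
    ∃ b₀, 0 < b₀ ∧ min βm βp ≤ b₀ ∧
      ∀ t ∈ Ioo (x (i - 1)) (x i), t ≠ α ∧ betaPW βm βp α t = b₀ := by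
  rw [Finset.mem_Icc] at hi
  rcases lt_or_gt_of_ne hik with h | h
  · refine ⟨βm, hβm, min_le_left _ _, fun t ht => ?_⟩
    have h1 : t < α := ht.2.trans_le
      ((mesh_mono hx (by omega : i ≤ k - 1) (by omega)).trans hl.le)
    exact ⟨h1.ne, if_pos h1⟩
  · refine ⟨βp, hβp, min_le_right _ _, fun t ht => ?_⟩
    have h1 : α < t := (hr.trans_le (mesh_mono hx (by omega : k ≤ i - 1) (by omega))).trans ht.1
    exact ⟨h1.ne', if_neg h1.not_gt⟩

/-- The lower order part `γe + c∫e + K` of the flux of the error. -/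
noncomputable def lowerOrder (γ c K a : ℝ) (e : ℝ → ℝ) (t : ℝ) : ℝ :=
  γ * e t + c * (∫ s in a..t, e s) + K

/-- The part of the error `e` not accounted for by the lower order flux. -/
noncomputable def defect (βm βp α γ c K a : ℝ) (e : ℝ → ℝ) (x : ℝ) : ℝ :=
  e x - weightedPrimitive βm βp α (fun x => ∫ t in a..x, lowerOrder γ c K a e t) x

/-- The flux `D 0 - Q i` of the error minus its lower order part, on the element `i`. -/
noncomputable def fluxResidual (γ c K a : ℝ) (e : ℝ → ℝ) (D : ℕ → ℝ → ℝ) (Q : ℕ → Polynomial ℝ)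
    (i : ℕ) (t : ℝ) : ℝ :=
  D 0 t - (Q i).eval t - lowerOrder γ c K a e t

/-- The error equation in flux form: `D` collects the exact flux and its derivatives, `Q i` is
the discrete flux on the element `i`, and at the nodes the flux of the error equals its lower
order part. -/
structure IsErrorFlux (p N k : ℕ) (βm βp γ c B a b α K : ℝ) (x : ℕ → ℝ) (g A : ℕ → ℕ → ℝ)
    (e : ℝ → ℝ) (D : ℕ → ℝ → ℝ) (Q : ℕ → Polynomial ℝ) : Prop where
  two_le : 2 ≤ p
  betaM_pos : 0 < βm
  betaP_pos : 0 < βp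
  c_pos : 0 < c
  one_le_k : 1 ≤ k
  k_le : k ≤ N
  first : x 0 = a
  last : x N = b
  step : ∀ i, i < N → x i < x (i + 1)
  lt_interface : x (k - 1) < α
  interface_lt : α < x k
  rule : ∀ i ∈ Finset.Icc 1 N, IsGaussRule p (min βm βp) (max βm βp) (betaPW βm βp α)
    (x (i - 1)) (x i) (g i) (A i)
  continuous_e : Continuous e
  e_left : e a = 0
  e_right : e b = 0
  continuousOn_D : ∀ j ≤ 2 * p, ContinuousOn (D j) (Icc a b)
  hasDerivAt_D : ∀ j < 2 * p, ∀ t ∈ Ioo a b, t ≠ α → HasDerivAt (D j) (D (j + 1) t) t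
  abs_D_le : ∀ j ≤ 2 * p, ∀ t ∈ Icc a b, |D j t| ≤ B
  natDegree_Q : ∀ i ∈ Finset.Icc 1 N, (Q i).natDegree < p
  hasDerivAt_e : ∀ i ∈ Finset.Icc 1 N, ∀ t ∈ Ioo (x (i - 1)) (x i), t ≠ α →
    HasDerivAt e ((D 0 t - (Q i).eval t) / betaPW βm βp α t) t
  node : ∀ i ∈ Finset.Icc 1 N, ∀ j ∈ Finset.Icc 1 p,
    D 0 (g i j) - (Q i).eval (g i j) = lowerOrder γ c K a e (g i j)

namespace IsErrorFlux

variable {p N k : ℕ} {βm βp γ c B a b α K : ℝ} {x : ℕ → ℝ} {g A : ℕ → ℕ → ℝ} {e : ℝ → ℝ}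
  {D : ℕ → ℝ → ℝ} {Q : ℕ → Polynomial ℝ}

local notation "ρ" => defect βm βp α γ c K a e
local notation "res" => fluxResidual γ c K a e D Q
local notation "low" => lowerOrder γ c K a e
local notation "β" => betaPW βm βp α

theorem m_pos (S : IsErrorFlux p N k βm βp γ c B a b α K x g A e D Q) : 0 < min βm βp :=
  lt_min S.betaM_pos S.betaP_pos

theorem element_lt (S : IsErrorFlux p N k βm βp γ c B a b α K x g A e D Q) {i : ℕ}
    (hi : i ∈ Finset.Icc 1 N) : x (i - 1) < x i := (S.rule i hi).lt

theorem left_le (S : IsErrorFlux p N k βm βp γ c B a b α K x g A e D Q) {i : ℕ}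
    (hi : i ≤ N) : a ≤ x i := S.first ▸ mesh_mono S.step (Nat.zero_le i) hi

theorem le_right (S : IsErrorFlux p N k βm βp γ c B a b α K x g A e D Q) {i : ℕ}
    (hi : i ≤ N) : x i ≤ b := S.last ▸ mesh_mono S.step hi le_rfl

theorem element_subset (S : IsErrorFlux p N k βm βp γ c B a b α K x g A e D Q) {i : ℕ}
    (hi : i ∈ Finset.Icc 1 N) : Icc (x (i - 1)) (x i) ⊆ Icc a b := by
  rw [Finset.mem_Icc] at hi
  exact Icc_subset_Icc (S.left_le (by omega)) (S.le_right hi.2)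

theorem interior_subset (S : IsErrorFlux p N k βm βp γ c B a b α K x g A e D Q) {i : ℕ}
    (hi : i ∈ Finset.Icc 1 N) : Ioo (x (i - 1)) (x i) ⊆ Ioo a b := by
  rw [Finset.mem_Icc] at hi
  exact Ioo_subset_Ioo (S.left_le (by omega)) (S.le_right hi.2)

theorem left_lt_interface (S : IsErrorFlux p N k βm βp γ c B a b α K x g A e D Q) : a < α :=
  (S.left_le (by have := S.k_le; omega)).trans_lt S.lt_interface

theorem interface_lt_right (S : IsErrorFlux p N k βm βp γ c B a b α K x g A e D Q) : α < b :=
  S.interface_lt.trans_le (S.le_right S.k_le)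

theorem exists_element (S : IsErrorFlux p N k βm βp γ c B a b α K x g A e D Q) {t : ℝ}
    (ht : t ∈ Icc a b) : ∃ i ∈ Finset.Icc 1 N, t ∈ Icc (x (i - 1)) (x i) :=
  exists_mem_element S.step (S.one_le_k.trans S.k_le) (by rwa [S.first, S.last])

theorem hasDerivAt_integral_e (S : IsErrorFlux p N k βm βp γ c B a b α K x g A e D Q) (t : ℝ) :
    HasDerivAt (fun x => ∫ s in a..x, e s) (e t) t := hasDerivAt_integral_right S.continuous_e a t

theorem continuous_lowerOrder (S : IsErrorFlux p N k βm βp γ c B a b α K x g A e D Q) :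
    Continuous low := by
  have h1 : Continuous fun x => ∫ s in a..x, e s :=
    continuous_iff_continuousAt.2 fun t => (S.hasDerivAt_integral_e t).continuousAt
  have h2 := S.continuous_e
  unfold lowerOrder
  fun_prop

theorem continuous_defect (S : IsErrorFlux p N k βm βp γ c B a b α K x g A e D Q) :
    Continuous ρ :=
  S.continuous_e.sub (continuous_weightedPrimitive _ _ _ (continuous_iff_continuousAt.2 fun t =>
    (hasDerivAt_integral_right S.continuous_lowerOrder a t).continuousAt))

theorem continuousOn_flux (S : IsErrorFlux p N k βm βp γ c B a b α K x g A e D Q) {i : ℕ}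
    (hi : i ∈ Finset.Icc 1 N) :
    ContinuousOn (fun t => D 0 t - (Q i).eval t) (Icc (x (i - 1)) (x i)) :=
  ((S.continuousOn_D 0 (by omega)).mono (S.element_subset hi)).sub
    (Q i).continuous.continuousOn

theorem continuousOn_residual (S : IsErrorFlux p N k βm βp γ c B a b α K x g A e D Q) {i : ℕ}
    (hi : i ∈ Finset.Icc 1 N) : ContinuousOn (res i) (Icc (x (i - 1)) (x i)) :=
  (S.continuousOn_flux hi).sub S.continuous_lowerOrder.continuousOn

theorem residual_node (S : IsErrorFlux p N k βm βp γ c B a b α K x g A e D Q) {i j : ℕ}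
    (hi : i ∈ Finset.Icc 1 N) (hj : j ∈ Finset.Icc 1 p) : res i (g i j) = 0 :=
  sub_eq_zero.2 (S.node i hi j hj)

theorem hasDerivAt_defect (S : IsErrorFlux p N k βm βp γ c B a b α K x g A e D Q) {i : ℕ}
    (hi : i ∈ Finset.Icc 1 N) {t : ℝ} (ht : t ∈ Ioo (x (i - 1)) (x i)) (hne : t ≠ α) :
    HasDerivAt ρ (res i t / β t) t := by
  refine ((S.hasDerivAt_e i hi t ht hne).sub (hasDerivAt_weightedPrimitive βm βp hne
    (hasDerivAt_integral_right S.continuous_lowerOrder a t))).congr_deriv ?_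
  rw [fluxResidual]
  ring

theorem defect_left (S : IsErrorFlux p N k βm βp γ c B a b α K x g A e D Q) : ρ a = 0 := by
  have h := S.left_lt_interface.le
  simp [defect, weightedPrimitive, min_eq_left h, max_eq_right h, S.e_left]

theorem integral_residual (S : IsErrorFlux p N k βm βp γ c B a b α K x g A e D Q) {i : ℕ}
    (hi : i ∈ Finset.Icc 1 N) {t : ℝ} (ht : t ∈ Icc (x (i - 1)) (x i)) :
    ∫ s in (x (i - 1))..t, res i s / β s = ρ t - ρ (x (i - 1)) := by
  have G := S.rule i hi
  refine MeasureTheory.integral_eq_of_hasDerivAt_off_countable _ _ (countable_singleton α)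
    S.continuous_defect.continuousOn (fun s hs => ?_)
    (intervalIntegrable_div G.pos G.meas G.lower ht.1
      ((S.continuousOn_residual hi).mono (Icc_subset_Icc_right ht.2)))
  rw [min_eq_left ht.1, max_eq_right ht.1] at hs
  exact S.hasDerivAt_defect hi ⟨hs.1.1, hs.1.2.trans_le ht.2⟩ hs.2

theorem integral_mul_residual (S : IsErrorFlux p N k βm βp γ c B a b α K x g A e D Q) {i : ℕ}
    (hi : i ∈ Finset.Icc 1 N) :
    ∫ t in (x (i - 1))..(x i), ρ t = (x i - x (i - 1)) * ρ (x (i - 1))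
      + ∫ t in (x (i - 1))..(x i), res i t * (Polynomial.C (x i) - Polynomial.X).eval t / β t := by
  have G := S.rule i hi
  have hρ := S.continuous_defect
  have hI : IntervalIntegrable
      (fun t => res i t * (Polynomial.C (x i) - Polynomial.X).eval t / β t)
      MeasureTheory.volume (x (i - 1)) (x i) :=
    intervalIntegrable_div G.pos G.meas G.lower G.lt.le
      ((S.continuousOn_residual hi).mul (Polynomial.continuous _).continuousOn)
  have hI' : IntervalIntegrable (fun t => ρ t - ρ (x (i - 1)))
      MeasureTheory.volume (x (i - 1)) (x i) :=
    (hρ.sub continuous_const).intervalIntegrable _ _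
  have h := MeasureTheory.integral_eq_of_hasDerivAt_off_countable (a := x (i - 1)) (b := x i)
    (fun t => (x i - t) * (ρ t - ρ (x (i - 1))))
    (fun t => res i t * (Polynomial.C (x i) - Polynomial.X).eval t / β t
      - (ρ t - ρ (x (i - 1)))) (countable_singleton α)
    (by fun_prop) (fun t ht => by
      rw [min_eq_left G.lt.le, max_eq_right G.lt.le] at ht
      refine (((hasDerivAt_id t).const_sub (x i)).mul
        ((S.hasDerivAt_defect hi ht.1 ht.2).sub_const (ρ (x (i - 1))))).congr_deriv ?_
      simp only [Polynomial.eval_sub, Polynomial.eval_C, Polynomial.eval_X, id]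
      ring) (hI.sub hI')
  rw [intervalIntegral.integral_sub hI hI',
    intervalIntegral.integral_sub (hρ.intervalIntegrable _ _) (by simp),
    intervalIntegral.integral_const] at h
  simp only [sub_self, zero_mul, mul_zero, smul_eq_mul] at h
  linarith

/-- Boundedness of the defect, in terms of elementwise bounds of the residual. -/
theorem abs_defect_sub_le (S : IsErrorFlux p N k βm βp γ c B a b α K x g A e D Q) {i : ℕ}
    (hi : i ∈ Finset.Icc 1 N) {Y : ℝ} (hY : ∀ t ∈ Icc (x (i - 1)) (x i), |res i t| ≤ Y)
    {t : ℝ} (ht : t ∈ Icc (x (i - 1)) (x i)) :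
    |ρ t - ρ (x (i - 1))| ≤ Y / min βm βp * (t - x (i - 1)) := by
  rw [← S.integral_residual hi ht]
  exact abs_integral_div_le S.m_pos (S.rule i hi).lower ht.1
    fun s hs => hY s ⟨hs.1, hs.2.trans ht.2⟩

/-- A function vanishing at `a` with elementwise Lipschitz bounds is bounded. -/
theorem abs_le_of_lipschitz (S : IsErrorFlux p N k βm βp γ c B a b α K x g A e D Q)
    {φ : ℝ → ℝ} {Y : ℝ} (h0 : φ a = 0) (hY : 0 ≤ Y)
    (h : ∀ i ∈ Finset.Icc 1 N, ∀ t ∈ Icc (x (i - 1)) (x i),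
      |φ t - φ (x (i - 1))| ≤ Y * (t - x (i - 1))) {t : ℝ} (ht : t ∈ Icc a b) :
    |φ t| ≤ Y * (b - a) := by
  obtain ⟨i, hi, hit⟩ := S.exists_element ht
  have h1 := abs_sub_le_of_increments (N := N) (x := x) (φ := φ) (B := Y) 0 le_rfl
    (fun j hj => by
      simpa using h j hj (x j) (right_mem_Icc.2 (S.element_lt hj).le))
    (n := i - 1) (by rw [Finset.mem_Icc] at hi; omega)
  rw [S.first, h0, sub_zero] at h1
  have h2 := h i hi t hit
  have h3 := abs_add_le (φ t - φ (x (i - 1))) (φ (x (i - 1)))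
  rw [sub_add_cancel] at h3
  have h4 : Y * (t - a) ≤ Y * (b - a) := by gcongr; exact ht.2
  linarith

theorem abs_integral_le {φ : ℝ → ℝ} {Y t : ℝ} (hY : ∀ s ∈ Icc a b, |φ s| ≤ Y)
    (ht : t ∈ Icc a b) : |∫ s in a..t, φ s| ≤ Y * (b - a) := by
  have h0 : 0 ≤ Y := (abs_nonneg _).trans (hY t ht)
  have h := intervalIntegral.norm_integral_le_of_norm_le_const (a := a) (b := t) (f := φ) (C := Y)
    (fun s hs => by
      rw [uIoc_of_le ht.1] at hs
      exact hY s ⟨hs.1.le, hs.2.trans ht.2⟩)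
  rw [Real.norm_eq_abs, abs_of_nonneg (sub_nonneg.2 ht.1)] at h
  exact h.trans (by gcongr; exact ht.2)

/-- The flux of the error is bounded by the residual. -/
theorem exists_flux_bound (βm βp γ c d : ℝ) (hβm : 0 < βm) (hβp : 0 < βp) (hc : 0 < c)
    (hd : 0 < d) : ∃ C : ℝ, 0 < C ∧ ∀ (p N k : ℕ) (B a b α K : ℝ) (x : ℕ → ℝ) (g A : ℕ → ℕ → ℝ)
      (e : ℝ → ℝ) (D : ℕ → ℝ → ℝ) (Q : ℕ → Polynomial ℝ),
      IsErrorFlux p N k βm βp γ c B a b α K x g A e D Q → b - a = d → ∀ Y : ℝ,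
      (∀ i ∈ Finset.Icc 1 N, ∀ t ∈ Icc (x (i - 1)) (x i), |fluxResidual γ c K a e D Q i t| ≤ Y) →
      ∀ i ∈ Finset.Icc 1 N, ∀ t ∈ Icc (x (i - 1)) (x i), |D 0 t - (Q i).eval t| ≤ C * Y := by
  obtain ⟨C, hC, hstab⟩ := exists_stability_bound βm βp γ c d hβm hβp hc hd
  set m := min βm βp with hm
  have hm0 : 0 < m := lt_min hβm hβp
  set q₁ := d / m * (1 + d) with hq₁
  set q₂ := C * q₁ + d / m with hq₂
  refine ⟨|γ| * q₂ + c * (q₂ * d) + C * q₁ + 1, by positivity, ?_⟩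
  intro p N k B a b α K x g A e D Q S hab Y hY i hi t ht
  have hY0 : 0 ≤ Y := (abs_nonneg _).trans (hY i hi t ht)
  have hb : b ∈ Icc a b := right_mem_Icc.2 (by linarith)
  have hρ : ∀ s ∈ Icc a b, |defect βm βp α γ c K a e s| ≤ d / m * Y := fun s hs => by
    refine (S.abs_le_of_lipschitz (Y := Y / m) S.defect_left (by positivity)
      (fun j hj t ht => S.abs_defect_sub_le hj (hY j hj) ht) hs).trans (le_of_eq ?_)
    rw [hab]
    ring
  have hle : d / m * Y ≤ q₁ * Y := by
    have : 0 ≤ d / m * d * Y := by positivity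
    rw [hq₁]
    linarith
  have h := hstab a b α K (q₁ * Y) e (defect βm βp α γ c K a e) hab S.left_lt_interface
    S.interface_lt_right S.continuous_e S.continuous_defect
    (fun x => (sub_add_cancel _ _).symm) S.e_left S.e_right ((hρ b hb).trans hle)
    (fun x hx => (abs_integral_le hρ hx).trans (by
      rw [hab, hq₁]
      have : 0 ≤ d / m * Y := by positivity
      linarith))
  have he : ∀ s ∈ Icc a b, |e s| ≤ q₂ * Y := fun s hs => by
    have h1 := abs_add_le (e s - defect βm βp α γ c K a e s) (defect βm βp α γ c K a e s)
    rw [sub_add_cancel] at h1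
    have h2 := h.2 s hs
    have h3 := hρ s hs
    rw [hq₂]
    linarith
  have ht' := S.element_subset hi ht
  have h4 : |γ * e t| ≤ |γ| * (q₂ * Y) := by
    rw [abs_mul]
    exact mul_le_mul_of_nonneg_left (he t ht') (abs_nonneg _)
  have h5 : |c * ∫ s in a..t, e s| ≤ c * (q₂ * Y * d) := by
    rw [abs_mul, abs_of_pos hc, ← hab]
    exact mul_le_mul_of_nonneg_left (abs_integral_le he ht') hc.le
  have h6 : |lowerOrder γ c K a e t| ≤ |γ| * (q₂ * Y) + c * (q₂ * Y * d) + C * (q₁ * Y) :=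
    (abs_add_three _ _ _).trans (add_le_add (add_le_add h4 h5) h.1)
  have h7 := abs_add_le (fluxResidual γ c K a e D Q i t) (lowerOrder γ c K a e t)
  rw [fluxResidual, sub_add_cancel] at h7
  have h8 := hY i hi t ht
  rw [fluxResidual] at h8
  linarith

/-- On an element the lower order part varies by at most the flux times the mesh size. -/
theorem abs_lowerOrder_sub_le (S : IsErrorFlux p N k βm βp γ c B a b α K x g A e D Q) {X : ℝ}
    (hX : ∀ i ∈ Finset.Icc 1 N, ∀ t ∈ Icc (x (i - 1)) (x i), |D 0 t - (Q i).eval t| ≤ X)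
    {i : ℕ} (hi : i ∈ Finset.Icc 1 N) {t : ℝ} (ht : t ∈ Icc (x (i - 1)) (x i)) :
    |low t - low (x (i - 1))|
      ≤ (|γ| + c * (b - a)) / min βm βp * X * (x i - x (i - 1)) := by
  have hm := S.m_pos
  have hc := S.c_pos
  have hX0 : 0 ≤ X := (abs_nonneg _).trans (hX i hi t ht)
  have hslope : ∀ j ∈ Finset.Icc 1 N, ∀ s ∈ Icc (x (j - 1)) (x j),
      |(D 0 s - (Q j).eval s) / β s| ≤ X / min βm βp := fun j hj s hs => by
    have hlow := (S.rule j hj).lower s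
    rw [abs_div, abs_of_pos (hm.trans_le hlow)]
    exact div_le_div₀ hX0 (hX j hj s hs) hm hlow
  have he : ∀ s ∈ Icc a b, |e s| ≤ X / min βm βp * (b - a) := fun s hs =>
    S.abs_le_of_lipschitz S.e_left (by positivity) (fun j hj s hs =>
      abs_sub_le_of_hasDerivAt_off (α := α) hs.1 S.continuous_e.continuousOn
        (fun z hz hne => S.hasDerivAt_e j hj z ⟨hz.1, hz.2.trans_le hs.2⟩ hne)
        (fun z hz _ => hslope j hj z ⟨hz.1.le, hz.2.le.trans hs.2⟩)) hs
  have h := abs_sub_le_of_hasDerivAt_off (f := low) (α := α)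
    (f' := fun s => γ * ((D 0 s - (Q i).eval s) / β s) + c * e s)
    (B := |γ| * (X / min βm βp) + c * (X / min βm βp * (b - a))) ht.1
    S.continuous_lowerOrder.continuousOn
    (fun s hs hne => (((S.hasDerivAt_e i hi s ⟨hs.1, hs.2.trans_le ht.2⟩ hne).const_mul γ).add
      ((S.hasDerivAt_integral_e s).const_mul c)).add_const K)
    (fun s hs _ => by
      have hs' : s ∈ Icc (x (i - 1)) (x i) := ⟨hs.1.le, hs.2.le.trans ht.2⟩
      refine (abs_add_le _ _).trans (add_le_add ?_ ?_)
      · rw [abs_mul]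
        exact mul_le_mul_of_nonneg_left (hslope i hi s hs') (abs_nonneg _)
      · rw [abs_mul, abs_of_pos hc]
        exact mul_le_mul_of_nonneg_left (he s (S.element_subset hi hs')) hc.le)
  have hab : 0 ≤ b - a := by linarith [S.left_lt_interface, S.interface_lt_right]
  refine h.trans ?_
  have e1 : |γ| * (X / min βm βp) + c * (X / min βm βp * (b - a))
      = (|γ| + c * (b - a)) / min βm βp * X := by ring
  rw [e1]
  gcongr
  exact ht.2

/-- The residual is a polynomial up to the Taylor remainder of the exact flux and the variation
of the lower order part. -/
theorem exists_polynomial_approx_residual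
    (S : IsErrorFlux p N k βm βp γ c B a b α K x g A e D Q) {X h : ℝ}
    (hX : ∀ i ∈ Finset.Icc 1 N, ∀ t ∈ Icc (x (i - 1)) (x i), |D 0 t - (Q i).eval t| ≤ X)
    {i n : ℕ} (hi : i ∈ Finset.Icc 1 N) (hh : x i - x (i - 1) ≤ h) (hn : p ≤ n + 1)
    (hn' : n + 1 ≤ 2 * p) :
    ∃ s : Polynomial ℝ, s.natDegree ≤ n ∧ ∀ t ∈ Icc (x (i - 1)) (x i),
      |res i t - s.eval t|
        ≤ B * h ^ (n + 1) + (|γ| + c * (b - a)) / min βm βp * X * h := by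
  have hlt := S.element_lt hi
  have hm := S.m_pos
  have hc := S.c_pos
  have hab : 0 ≤ b - a := by linarith [S.left_lt_interface, S.interface_lt_right]
  have hl : x (i - 1) ∈ Icc (x (i - 1)) (x i) := left_mem_Icc.2 hlt.le
  have hX0 : 0 ≤ X := (abs_nonneg _).trans (hX i hi _ hl)
  have hB0 : 0 ≤ B := (abs_nonneg _).trans (S.abs_D_le 0 (by omega) _ (S.element_subset hi hl))
  obtain ⟨T, hT, hTb⟩ := exists_polynomial_approx (α := α) hlt.le hB0 n D
    (fun j hj => (S.continuousOn_D j (by omega)).mono (S.element_subset hi))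
    (fun j hj t ht => S.hasDerivAt_D j (by omega) t (S.interior_subset hi ht))
    (fun t ht => S.abs_D_le (n + 1) (by omega) t
      (S.element_subset hi (Ioo_subset_Icc_self ht)))
  refine ⟨T - Q i - Polynomial.C (low (x (i - 1))), ?_, fun t ht => ?_⟩
  · have hQ := S.natDegree_Q i hi
    refine (Polynomial.natDegree_sub_le_of_le (Polynomial.natDegree_sub_le_of_le hT
      (by omega : (Q i).natDegree ≤ n)) (by simp : _ ≤ n)).trans (by simp)
  · have e1 : res i t - (T - Q i - Polynomial.C (low (x (i - 1)))).eval t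
        = (D 0 t - T.eval t) - (low t - low (x (i - 1))) := by
      simp only [fluxResidual, Polynomial.eval_sub, Polynomial.eval_C]
      ring
    rw [e1]
    refine (abs_sub _ _).trans (add_le_add ((hTb t ht).trans ?_)
      ((S.abs_lowerOrder_sub_le hX hi ht).trans ?_))
    · have : 0 ≤ x i - x (i - 1) := by linarith
      gcongr
    · gcongr

/-- Away from the interface the residual has two more orders of smoothness. -/
theorem exists_polynomial_approx_residual_of_ne
    (S : IsErrorFlux p N k βm βp γ c B a b α K x g A e D Q) {h : ℝ} {i : ℕ}
    (hi : i ∈ Finset.Icc 1 N) (hik : i ≠ k) (hh : x i - x (i - 1) ≤ h) :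
    ∃ s : Polynomial ℝ, s.natDegree ≤ p + 1 ∧ ∀ t ∈ Icc (x (i - 1)) (x i),
      |res i t - s.eval t| ≤ (1 + (|γ| + c) / min βm βp) * B * h ^ (p + 2) := by
  obtain ⟨b₀, hb₀, hmb, hβ⟩ := betaPW_eq_on_element S.betaM_pos S.betaP_pos S.step S.k_le
    S.lt_interface S.interface_lt hi hik
  have hlt := S.element_lt hi
  have hm := S.m_pos
  have hc := S.c_pos
  have hp := S.two_le
  have hsub := S.element_subset hi
  have hl : x (i - 1) ∈ Icc (x (i - 1)) (x i) := left_mem_Icc.2 hlt.le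
  have hB0 : 0 ≤ B := (abs_nonneg _).trans (S.abs_D_le 0 (by omega) _ (hsub hl))
  have hQ := S.natDegree_Q i hi
  set E : ℕ → ℝ → ℝ := fun j t => D j t - ((⇑Polynomial.derivative)^[j] (Q i)).eval t with hE
  have hEc : ∀ j ≤ 2 * p, ContinuousOn (E j) (Icc (x (i - 1)) (x i)) := fun j hj =>
    ((S.continuousOn_D j hj).mono hsub).sub (Polynomial.continuous _).continuousOn
  have hEd : ∀ j < 2 * p, ∀ t ∈ Ioo (x (i - 1)) (x i), HasDerivAt (E j) (E (j + 1) t) t := by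
    intro j hj t ht
    have h1 := S.hasDerivAt_D j hj t (S.interior_subset hi ht) (hβ t ht).1
    have h2 := ((⇑Polynomial.derivative)^[j] (Q i)).hasDerivAt t
    refine (h1.sub h2).congr_deriv ?_
    simp only [hE, Function.iterate_succ_apply']
  have hed : ∀ t ∈ Ioo (x (i - 1)) (x i), HasDerivAt e (E 0 t / b₀) t := by
    intro t ht
    have h1 := S.hasDerivAt_e i hi t ht (hβ t ht).1
    rwa [(hβ t ht).2] at h1
  have hEtop : ∀ j, p ≤ j → j ≤ 2 * p → ∀ t ∈ Icc (x (i - 1)) (x i), |E j t| ≤ B := by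
    intro j hj hj' t ht
    simp only [hE]
    rw [Polynomial.iterate_derivative_eq_zero (hQ.trans_le hj), Polynomial.eval_zero, sub_zero]
    exact S.abs_D_le j hj' t (hsub ht)
  set F : ℕ → ℝ → ℝ := fun j => match j with
    | 0 => res i
    | 1 => fun t => E 1 t - γ * (E 0 t / b₀) - c * e t
    | j + 2 => fun t => E (j + 2) t - γ * (E (j + 1) t / b₀) - c * (E j t / b₀) with hF
  have hec : ContinuousOn e (Icc (x (i - 1)) (x i)) := S.continuous_e.continuousOn
  obtain ⟨T, hT, hTb⟩ := exists_polynomial_approx (α := α)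
    (B := (1 + (|γ| + c) / min βm βp) * B) hlt.le (by positivity) (p + 1) F
    (fun j hj => by
      match j, hj with
      | 0, _ => exact S.continuousOn_residual hi
      | 1, _ =>
        exact ((hEc 1 (by omega)).sub (((hEc 0 (by omega)).div_const b₀).const_mul γ)).sub
          (hec.const_mul c)
      | j + 2, hj =>
        exact ((hEc (j + 2) (by omega)).sub
          (((hEc (j + 1) (by omega)).div_const b₀).const_mul γ)).sub
          (((hEc j (by omega)).div_const b₀).const_mul c))
    (fun j hj t ht _ => by
      match j, hj with
      | 0, _ =>
        have h1 := (hEd 0 (by omega) t ht).sub ((((hed t ht).const_mul γ).add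
          ((S.hasDerivAt_integral_e t).const_mul c)).add_const K)
        change HasDerivAt (fun t => E 0 t - lowerOrder γ c K a e t)
          (E 1 t - γ * (E 0 t / b₀) - c * e t) t
        exact h1.congr_deriv (by ring)
      | 1, _ =>
        exact ((hEd 1 (by omega) t ht).sub
          (((hEd 0 (by omega) t ht).div_const b₀).const_mul γ)).sub ((hed t ht).const_mul c)
      | j + 2, hj =>
        exact ((hEd (j + 2) (by omega) t ht).sub
          (((hEd (j + 1) (by omega) t ht).div_const b₀).const_mul γ)).sub
          (((hEd j (by omega) t ht).div_const b₀).const_mul c))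
    (fun t ht => by
      have ht' := Ioo_subset_Icc_self ht
      have hdiv : ∀ j, p ≤ j → j ≤ 2 * p → |E j t / b₀| ≤ B / min βm βp := fun j hj hj' => by
        rw [abs_div, abs_of_pos hb₀]
        exact div_le_div₀ hB0 (hEtop j hj hj' t ht') hm hmb
      have h1 := hEtop (p + 2) (by omega) (by omega) t ht'
      have h2 := mul_le_mul_of_nonneg_left (hdiv (p + 1) (by omega) (by omega)) (abs_nonneg γ)
      have h3 := mul_le_mul_of_nonneg_left (hdiv p le_rfl (by omega)) hc.le
      change |E (p + 2) t - γ * (E (p + 1) t / b₀) - c * (E p t / b₀)| ≤ _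
      refine (abs_sub _ _).trans ((add_le_add_left (abs_sub _ _) _).trans ?_)
      rw [abs_mul, abs_mul, abs_of_pos hc]
      refine (add_le_add (add_le_add h1 h2) h3).trans (le_of_eq ?_)
      ring)
  refine ⟨T, hT, fun t ht => (hTb t ht).trans ?_⟩
  have : 0 ≤ x i - x (i - 1) := by linarith
  gcongr

end IsErrorFlux

namespace IsErrorFlux

variable {p N k : ℕ} {βm βp γ c B a b α K : ℝ} {x : ℕ → ℝ} {g A : ℕ → ℕ → ℝ} {e : ℝ → ℝ}
  {D : ℕ → ℝ → ℝ} {Q : ℕ → Polynomial ℝ}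

theorem nonneg_bound (S : IsErrorFlux p N k βm βp γ c B a b α K x g A e D Q) : 0 ≤ B :=
  (abs_nonneg _).trans (S.abs_D_le 0 (by omega) a
    (left_mem_Icc.2 (S.left_lt_interface.trans S.interface_lt_right).le))

theorem one_mem (S : IsErrorFlux p N k βm βp γ c B a b α K x g A e D Q) :
    1 ∈ Finset.Icc 1 N := Finset.mem_Icc.2 ⟨le_rfl, S.one_le_k.trans S.k_le⟩

/-- The flux of the error attains its maximal modulus. -/
theorem exists_abs_flux_max (S : IsErrorFlux p N k βm βp γ c B a b α K x g A e D Q) :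
    ∃ i₀ ∈ Finset.Icc 1 N, ∃ t₀ ∈ Icc (x (i₀ - 1)) (x i₀), ∀ i ∈ Finset.Icc 1 N,
      ∀ t ∈ Icc (x (i - 1)) (x i), |D 0 t - (Q i).eval t| ≤ |D 0 t₀ - (Q i₀).eval t₀| := by
  have h : ∀ i ∈ Finset.Icc 1 N, ∃ τ ∈ Icc (x (i - 1)) (x i), ∀ t ∈ Icc (x (i - 1)) (x i),
      |D 0 t - (Q i).eval t| ≤ |D 0 τ - (Q i).eval τ| := fun i hi =>
    isCompact_Icc.exists_isMaxOn (nonempty_Icc.2 (S.element_lt hi).le) (S.continuousOn_flux hi).abs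
  choose! τ hτ hmax using h
  obtain ⟨i₀, hi₀, hle⟩ := Finset.exists_max_image (Finset.Icc 1 N)
    (fun i => |D 0 (τ i) - (Q i).eval (τ i)|) ⟨1, S.one_mem⟩
  exact ⟨i₀, hi₀, τ i₀, hτ i₀ hi₀, fun i hi t ht => (hmax i hi t ht).trans (hle i hi)⟩

/-- Optimal order bounds for the residual and the flux of the error. -/
theorem exists_residual_flux_bound (p : ℕ) (βm βp γ c d : ℝ) (hβm : 0 < βm) (hβp : 0 < βp)
    (hc : 0 < c) (hd : 0 < d) : ∃ h₀ C : ℝ, 0 < h₀ ∧ 0 < C ∧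
      ∀ (N k : ℕ) (B a b α K h : ℝ) (x : ℕ → ℝ) (g A : ℕ → ℕ → ℝ)
      (e : ℝ → ℝ) (D : ℕ → ℝ → ℝ) (Q : ℕ → Polynomial ℝ),
      IsErrorFlux p N k βm βp γ c B a b α K x g A e D Q → b - a = d →
      (∀ i ∈ Finset.Icc 1 N, x i - x (i - 1) ≤ h) → h ≤ h₀ →
      ∀ i ∈ Finset.Icc 1 N, ∀ t ∈ Icc (x (i - 1)) (x i),
        |fluxResidual γ c K a e D Q i t| ≤ C * B * h ^ p ∧
        |D 0 t - (Q i).eval t| ≤ C * B * h ^ p := by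
  obtain ⟨Cn, hCn, hnode⟩ := IsGaussRule.exists_abs_eval_le p (min βm βp) (max βm βp)
  obtain ⟨C₁, hC₁, hflux⟩ := exists_flux_bound βm βp γ c d hβm hβp hc hd
  have hm : 0 < min βm βp := lt_min hβm hβp
  set C₂ := (|γ| + c * d) / min βm βp with hC₂
  have hC₂0 : 0 < C₂ := by positivity
  set q := C₁ * (1 + Cn) with hq
  have hq0 : 0 < q := by positivity
  refine ⟨min 1 (1 / (2 * q * C₂)), (1 + Cn) * (1 + C₂ * (2 * q)) + 2 * q, by positivity,
    by positivity, ?_⟩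
  intro N k B a b α K h x g A e D Q S hab hh hh₀ i hi t ht
  have hB := S.nonneg_bound
  have hp := S.two_le
  have h0 : 0 ≤ h := (sub_pos.2 (S.element_lt hi)).le.trans (hh i hi)
  have hstep : ∀ X, (∀ i ∈ Finset.Icc 1 N, ∀ t ∈ Icc (x (i - 1)) (x i),
      |D 0 t - (Q i).eval t| ≤ X) → ∀ i ∈ Finset.Icc 1 N, ∀ t ∈ Icc (x (i - 1)) (x i),
      |fluxResidual γ c K a e D Q i t| ≤ (1 + Cn) * (B * h ^ p + C₂ * X * h) := by
    intro X hX i hi t ht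
    obtain ⟨s, hs, hsb⟩ := S.exists_polynomial_approx_residual (n := p - 1) hX hi (hh i hi)
      (by omega) (by omega)
    rw [Nat.sub_add_cancel (by omega), hab, ← hC₂] at hsb
    have h1 := hnode _ _ _ _ _ (S.rule i hi) s (B * h ^ p + C₂ * X * h) (by omega)
      (fun j hj => by
        have h2 := hsb _ (Ioo_subset_Icc_self ((S.rule i hi).mem j hj))
        rwa [S.residual_node hi hj, zero_sub, abs_neg] at h2) t ht
    have h3 := abs_add_le (fluxResidual γ c K a e D Q i t - s.eval t) (s.eval t)
    rw [sub_add_cancel] at h3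
    linarith [hsb t ht]
  obtain ⟨i₀, hi₀, t₀, ht₀, hmax⟩ := S.exists_abs_flux_max
  set X := |D 0 t₀ - (Q i₀).eval t₀| with hX
  have hX0 : 0 ≤ X := abs_nonneg _
  have hres := hstep X hmax
  have h1 := hflux p N k B a b α K x g A e D Q S hab _ hres i₀ hi₀ t₀ ht₀
  rw [← hX] at h1
  have h2 : 2 * q * C₂ * h ≤ 1 := by
    have := hh₀.trans (min_le_right _ _)
    rwa [le_div_iff₀ (by positivity), mul_comm] at this
  have h3 : q * C₂ * h * X ≤ 1 / 2 * X := mul_le_mul_of_nonneg_right (by linarith) hX0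
  have hP : 0 ≤ B * h ^ p := by positivity
  have hXb : X ≤ 2 * q * (B * h ^ p) := by
    have : C₁ * ((1 + Cn) * (B * h ^ p + C₂ * X * h))
      = q * (B * h ^ p) + q * C₂ * h * X := by rw [hq]; ring
    linarith
  have h4 : C₂ * X * h ≤ C₂ * (2 * q * (B * h ^ p)) := by
    have h5 : h ≤ 1 := hh₀.trans (min_le_left _ _)
    calc C₂ * X * h ≤ C₂ * X * 1 := by gcongr
      _ ≤ _ := by rw [mul_one]; gcongr
  constructor
  · have h5 := hres i hi t ht
    have h6 : (1 + Cn) * (B * h ^ p + C₂ * X * h)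
        ≤ (1 + Cn) * (B * h ^ p + C₂ * (2 * q * (B * h ^ p))) := by gcongr
    have h7 : 0 ≤ 2 * q * (B * h ^ p) := by positivity
    linarith
  · have h5 := hmax i hi t ht
    have h7 : 0 ≤ (1 + Cn) * (1 + C₂ * (2 * q)) * (B * h ^ p) := by positivity
    linarith

/-- Superconvergence of the error at the roots of the generalized Lobatto function. -/
theorem exists_lobatto_bound (p : ℕ) (βm βp γ c d : ℝ) (hβm : 0 < βm) (hβp : 0 < βp)
    (hc : 0 < c) (hd : 0 < d) : ∃ h₀ C : ℝ, 0 < h₀ ∧ 0 < C ∧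
      ∀ (N k : ℕ) (B a b α K h : ℝ) (x : ℕ → ℝ) (g A : ℕ → ℕ → ℝ)
      (e : ℝ → ℝ) (D : ℕ → ℝ → ℝ) (Q : ℕ → Polynomial ℝ),
      IsErrorFlux p N k βm βp γ c B a b α K x g A e D Q → b - a = d →
      (∀ i ∈ Finset.Icc 1 N, x i - x (i - 1) ≤ h) → h ≤ h₀ →
      ∀ i ∈ Finset.Icc 1 N, ∀ L : Polynomial ℝ, L.degree = (p : WithBot ℕ) →
      (∀ q : Polynomial ℝ, q.natDegree < p →
        ∫ t in (x (i - 1))..(x i), L.eval t * q.eval t / betaPW βm βp α t = 0) →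
      ∀ z ∈ Icc (x (i - 1)) (x i),
        (∫ t in (x (i - 1))..z, L.eval t / betaPW βm βp α t) = 0 →
        |e z| ≤ C * B * h ^ (p + 2) := by
  obtain ⟨Cn, hCn, hnode⟩ := IsGaussRule.exists_abs_eval_le p (min βm βp) (max βm βp)
  obtain ⟨h₀, C₃, hh₀, hC₃, hfl⟩ :=
    exists_residual_flux_bound p βm βp γ c d hβm hβp hc hd
  obtain ⟨Cs, hCs, hstab⟩ := exists_stability_bound βm βp γ c d hβm hβp hc hd
  have hm : 0 < min βm βp := lt_min hβm hβp
  set m := min βm βp with hmdef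
  set C₂ := (|γ| + c * d) / m with hC₂
  have hC₂0 : 0 < C₂ := by positivity
  set C₅ := 1 + C₂ * C₃ with hC₅
  set C₆ := 1 + (|γ| + c) / m with hC₆
  have hC₅0 : 0 < C₅ := by positivity
  have hC₆0 : 0 < C₆ := by positivity
  set C₇ := 2 / m * C₆ * d + 2 / m * C₅ with hC₇
  have hC₇0 : 0 < C₇ := by positivity
  set C₉ := (C₇ + 2 / m * C₅) * d + (C₇ + C₃ / m) with hC₉
  have hC₉0 : 0 < C₉ := by positivity
  refine ⟨min 1 h₀, Cs * (C₇ + C₉) + C₇ + (1 + Cn) * C₅ / m, by positivity, by positivity, ?_⟩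
  intro N k B a b α K h x g A e D Q S hab hh hhh i hi L hL horth z hz hLz
  have hB := S.nonneg_bound
  have hp := S.two_le
  have hr := fun i hi t ht => hfl N k B a b α K h x g A e D Q S hab hh
    (hhh.trans (min_le_right _ _)) i hi t ht
  have h0 : 0 ≤ h := (sub_pos.2 (S.element_lt hi)).le.trans (hh i hi)
  have h1 : h ≤ 1 := hhh.trans (min_le_left _ _)
  set P := B * h ^ (p + 2) with hP
  have hP0 : 0 ≤ P := by positivity
  have happrox : ∀ i ∈ Finset.Icc 1 N, ∃ s : Polynomial ℝ, s.natDegree ≤ p ∧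
      ∀ t ∈ Icc (x (i - 1)) (x i),
        |fluxResidual γ c K a e D Q i t - s.eval t| ≤ C₅ * B * h ^ (p + 1) := by
    intro i hi
    obtain ⟨s, hs, hsb⟩ := S.exists_polynomial_approx_residual (n := p)
      (fun i hi t ht => (hr i hi t ht).2) hi (hh i hi) (by omega) (by omega)
    refine ⟨s, hs, fun t ht => (hsb t ht).trans (le_of_eq ?_)⟩
    rw [hab, ← hmdef, ← hC₂, hC₅]
    ring
  have hends : ∀ n ≤ N, |defect βm βp α γ c K a e (x n)| ≤ C₇ * P := by
    intro n hn
    have h2 := abs_sub_le_of_increments (N := N) (x := x) (φ := defect βm βp α γ c K a e)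
      (B := 2 / m * C₆ * P) (B' := 2 / m * C₅ * P) k (by positivity) (fun j hj => by
        have hright := right_mem_Icc.2 (S.element_lt hj).le
        rw [← S.integral_residual hj hright]
        have hlen := hh j hj
        have hlen0 : 0 ≤ x j - x (j - 1) := (sub_pos.2 (S.element_lt hj)).le
        split_ifs with hjk
        · obtain ⟨s, hs, hsb⟩ := happrox j hj
          have h3 := (S.rule j hj).abs_integral_mul_le (T := 1) (τ := 1)
            (S.continuousOn_residual hj) (fun l hl => S.residual_node hj hl) hsb (by simp)
            (by rw [Polynomial.natDegree_one]; omega)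
          simp only [Polynomial.eval_one, mul_one] at h3
          have h4 : 2 / m * (x j - x (j - 1)) * (C₅ * B * h ^ (p + 1))
              ≤ 2 / m * h * (C₅ * B * h ^ (p + 1)) := by gcongr
          have h5 : 2 / m * h * (C₅ * B * h ^ (p + 1)) = 2 / m * C₅ * P := by rw [hP]; ring
          have h6 : 0 ≤ 2 / m * C₆ * P * (x j - x (j - 1)) := by positivity
          linarith
        · obtain ⟨s, hs, hsb⟩ := S.exists_polynomial_approx_residual_of_ne hj hjk hlen
          have h3 := (S.rule j hj).abs_integral_mul_le (T := 1) (τ := 1)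
            (S.continuousOn_residual hj) (fun l hl => S.residual_node hj hl) hsb (by simp)
            (by rw [Polynomial.natDegree_one]; omega)
          simp only [Polynomial.eval_one, mul_one] at h3
          refine h3.trans (le_of_eq ?_)
          rw [hP, hC₆]
          ring) hn
    rw [S.first, S.defect_left, sub_zero] at h2
    have h3 : 2 / m * C₆ * P * (x n - a) ≤ 2 / m * C₆ * P * d := by
      have := S.le_right hn
      gcongr
      linarith
    have h4 : C₇ * P = 2 / m * C₆ * P * d + 2 / m * C₅ * P := by rw [hC₇]; ring
    linarith
  have hdefect : ∀ i ∈ Finset.Icc 1 N, ∀ t ∈ Icc (x (i - 1)) (x i),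
      |defect βm βp α γ c K a e t| ≤ C₇ * P + C₃ / m * B * h ^ (p + 1) := by
    intro i hi t ht
    have h2 := hends (i - 1) (by rw [Finset.mem_Icc] at hi; omega)
    have h3 := S.abs_defect_sub_le hi (fun s hs => (hr i hi s hs).1) ht
    have h4 := abs_add_le (defect βm βp α γ c K a e t - defect βm βp α γ c K a e (x (i - 1)))
      (defect βm βp α γ c K a e (x (i - 1)))
    rw [sub_add_cancel] at h4
    have h5 : C₃ * B * h ^ p / m * (t - x (i - 1)) ≤ C₃ * B * h ^ p / m * h := by
      have := hh i hi
      have := ht.2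
      gcongr
      linarith
    have h6 : C₃ * B * h ^ p / m * h = C₃ / m * B * h ^ (p + 1) := by ring
    linarith
  have hρc := S.continuous_defect
  have hint : ∀ u v, IntervalIntegrable (defect βm βp α γ c K a e) MeasureTheory.volume u v :=
    fun u v => hρc.intervalIntegrable u v
  set R : ℝ → ℝ := fun t => ∫ s in a..t, defect βm βp α γ c K a e s with hR
  have hRsub : ∀ u v, R v - R u = ∫ s in u..v, defect βm βp α γ c K a e s := fun u v =>
    intervalIntegral.integral_interval_sub_left (hint _ _) (hint _ _)
  have hRends : ∀ n ≤ N, |R (x n)| ≤ (C₇ + 2 / m * C₅) * d * P := by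
    intro n hn
    have h2 := abs_sub_le_of_increments (N := N) (x := x) (φ := R)
      (B := (C₇ + 2 / m * C₅) * P) (B' := 0) 0 le_rfl (fun j hj => by
        have hlt := S.element_lt hj
        have hlen := hh j hj
        have hlen0 : 0 ≤ x j - x (j - 1) := (sub_pos.2 hlt).le
        rw [hRsub, S.integral_mul_residual hj]
        obtain ⟨s, hs, hsb⟩ := happrox j hj
        have h3 := (S.rule j hj).abs_integral_mul_le
          (T := Polynomial.C (x j) - Polynomial.X) (τ := h)
          (S.continuousOn_residual hj) (fun l hl => S.residual_node hj hl) hsb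
          (fun t ht => by
            rw [Polynomial.eval_sub, Polynomial.eval_C, Polynomial.eval_X, abs_le]
            constructor <;> linarith [ht.1, ht.2])
          (by
            have : (Polynomial.C (x j) - Polynomial.X : Polynomial ℝ).natDegree ≤ 1 :=
              (Polynomial.natDegree_sub_le _ _).trans (by simp)
            omega)
        have h4 := mul_le_mul_of_nonneg_left
          (hends (j - 1) (by rw [Finset.mem_Icc] at hj; omega)) hlen0
        have h5 := abs_add_le ((x j - x (j - 1)) * defect βm βp α γ c K a e (x (j - 1)))
          (∫ t in (x (j - 1))..(x j), fluxResidual γ c K a e D Q j t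
            * (Polynomial.C (x j) - Polynomial.X).eval t / betaPW βm βp α t)
        rw [abs_mul, abs_of_nonneg hlen0] at h5
        have h6 : 2 / m * (x j - x (j - 1)) * (C₅ * B * h ^ (p + 1) * h)
            = 2 / m * C₅ * P * (x j - x (j - 1)) := by rw [hP]; ring
        have h7 : (0 : ℝ) ≤ if j = 0 then (0 : ℝ) else 0 := by simp
        linarith) hn
    rw [S.first, hRsub, show (∫ s in a..x n, defect βm βp α γ c K a e s) = R (x n) from rfl] at h2
    have h3 : (C₇ + 2 / m * C₅) * P * (x n - a) ≤ (C₇ + 2 / m * C₅) * P * d := by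
      have := S.le_right hn
      gcongr
      linarith
    linarith
  have hRall : ∀ t ∈ Icc a b, |R t| ≤ C₉ * P := by
    intro t ht
    obtain ⟨j, hj, hjt⟩ := S.exists_element ht
    have h2 := hRends (j - 1) (by rw [Finset.mem_Icc] at hj; omega)
    have h3 := intervalIntegral.norm_integral_le_of_norm_le_const (a := x (j - 1)) (b := t)
      (f := defect βm βp α γ c K a e) (C := C₇ * P + C₃ / m * B * h ^ (p + 1)) (fun s hs => by
        rw [uIoc_of_le hjt.1] at hs
        exact hdefect j hj s ⟨hs.1.le, hs.2.trans hjt.2⟩)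
    rw [← hRsub, Real.norm_eq_abs, abs_of_nonneg (sub_nonneg.2 hjt.1)] at h3
    have h4 := abs_add_le (R t - R (x (j - 1))) (R (x (j - 1)))
    rw [sub_add_cancel] at h4
    have h5 : (C₇ * P + C₃ / m * B * h ^ (p + 1)) * (t - x (j - 1))
        ≤ (C₇ * P + C₃ / m * B * h ^ (p + 1)) * h := by
      have := hh j hj
      have := hjt.2
      gcongr
      linarith
    have h6 : C₇ * P * h ≤ C₇ * P := mul_le_of_le_one_right (by positivity) h1
    have h7 : (C₇ * P + C₃ / m * B * h ^ (p + 1)) * h = C₇ * P * h + C₃ / m * P := by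
      rw [hP]; ring
    have h8 : C₉ * P = (C₇ + 2 / m * C₅) * d * P + (C₇ * P + C₃ / m * P) := by rw [hC₉]; ring
    linarith
  have hz' := S.element_subset hi hz
  have h2 := (hstab a b α K ((C₇ + C₉) * P) e (defect βm βp α γ c K a e) hab
    S.left_lt_interface S.interface_lt_right S.continuous_e S.continuous_defect
    (fun x => (sub_add_cancel _ _).symm) S.e_left S.e_right
    (by
      have h3 := hends N le_rfl
      rw [S.last] at h3
      have : 0 ≤ C₉ * P := by positivity
      linarith)
    (fun t ht => by
      have h3 := hRall t ht
      have : 0 ≤ C₇ * P := by positivity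
      simp only [hR] at h3
      linarith)).2 z hz'
  obtain ⟨s, hs, hsb⟩ := happrox i hi
  have h3 := (S.rule i hi).abs_integral_lobatto_le hCn
    (hnode _ _ _ _ _ (S.rule i hi)) hL horth (S.continuousOn_residual hi)
    (fun l hl => S.residual_node hi hl) hsb hs hz hLz
  rw [S.integral_residual hi hz] at h3
  have h4 := hends (i - 1) (by rw [Finset.mem_Icc] at hi; omega)
  have h5 : (1 + Cn) * (C₅ * B * h ^ (p + 1)) / m * (x i - x (i - 1))
      ≤ (1 + Cn) * (C₅ * B * h ^ (p + 1)) / m * h := by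
    have := hh i hi
    gcongr
  have h6 : (1 + Cn) * (C₅ * B * h ^ (p + 1)) / m * h = (1 + Cn) * C₅ / m * P := by
    rw [hP]; ring
  have h7 := abs_add_three (e z - defect βm βp α γ c K a e z)
    (defect βm βp α γ c K a e z - defect βm βp α γ c K a e (x (i - 1)))
    (defect βm βp α γ c K a e (x (i - 1)))
  rw [sub_add_sub_cancel, sub_add_cancel] at h7
  have h8 : (Cs * (C₇ + C₉) + C₇ + (1 + Cn) * C₅ / m) * B * h ^ (p + 2)
      = Cs * ((C₇ + C₉) * P) + C₇ * P + (1 + Cn) * C₅ / m * P := by rw [hP]; ring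
  linarith

end IsErrorFlux

section ExactFlux

theorem hasDerivAt_iteratedDerivWithin {u : ℝ → ℝ} {l r t : ℝ} {m j : ℕ}
    (hu : ContDiffOn ℝ (m : ℕ∞) u (Icc l r)) (hj : j < m) (ht : t ∈ Ioo l r) :
    HasDerivAt (iteratedDerivWithin j u (Icc l r)) (iteratedDerivWithin (j + 1) u (Icc l r) t) t := by
  have h := hu.differentiableOn_iteratedDerivWithin (m := j) (by exact_mod_cast hj)
    (uniqueDiffOn_Icc (ht.1.trans ht.2)) t (Ioo_subset_Icc_self ht)
  rw [iteratedDerivWithin_succ]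
  exact h.hasDerivWithinAt.hasDerivAt (Icc_mem_nhds ht.1 ht.2)

theorem iteratedDeriv_two_eq {u : ℝ → ℝ} {l r t : ℝ} {m : ℕ}
    (hu : ContDiffOn ℝ (m : ℕ∞) u (Icc l r)) (hm : 2 ≤ m) (ht : t ∈ Ioo l r) :
    iteratedDeriv 2 u t = iteratedDerivWithin 2 u (Icc l r) t := by
  have h1 : deriv u =ᶠ[nhds t] iteratedDerivWithin 1 u (Icc l r) := by
    filter_upwards [Ioo_mem_nhds ht.1 ht.2] with s hs
    have h2 := hasDerivAt_iteratedDerivWithin (j := 0) hu (by omega) hs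
    rw [iteratedDerivWithin_zero] at h2
    exact h2.deriv
  rw [iteratedDeriv_succ, iteratedDeriv_one, h1.deriv_eq]
  exact (hasDerivAt_iteratedDerivWithin hu (by omega) ht).deriv

theorem abs_iteratedDerivWithin_le_sSup {u : ℝ → ℝ} {l r t : ℝ} {m j : ℕ} (hlr : l < r)
    (hu : ContDiffOn ℝ (m : ℕ∞) u (Icc l r)) (hj : j ≤ m) (ht : t ∈ Icc l r) :
    |iteratedDerivWithin j u (Icc l r) t| ≤ sSup {y : ℝ | ∃ j ≤ m, ∃ t ∈ Icc l r,
        y = |iteratedDerivWithin j u (Icc l r) t|} := by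
  refine le_csSup ?_ ⟨j, hj, t, ht, rfl⟩
  have h : ∀ i ≤ m, ∃ Y, ∀ s ∈ Icc l r, |iteratedDerivWithin i u (Icc l r) s| ≤ Y := fun i hi =>
    isCompact_Icc.exists_bound_of_continuousOn (hu.continuousOn_iteratedDerivWithin
      (by exact_mod_cast hi) (uniqueDiffOn_Icc hlr))
  choose! Y hY using h
  refine ⟨∑ i ∈ Finset.range (m + 1), |Y i|, ?_⟩
  rintro _ ⟨i, hi, s, hs, rfl⟩
  exact (hY i hi s hs).trans ((le_abs_self _).trans
    (Finset.single_le_sum (f := fun i => |Y i|) (fun i _ => abs_nonneg _)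
      (Finset.mem_range.2 (by omega))))

/-- The derivatives of the flux `βu'`. -/
noncomputable def exactFlux (a b α βm βp : ℝ) (u : ℝ → ℝ) (j : ℕ) (t : ℝ) : ℝ :=
  if t ≤ α then βm * iteratedDerivWithin (j + 1) u (Icc a α) t
  else βp * iteratedDerivWithin (j + 1) u (Icc α b) t

variable {a b α βm βp : ℝ} {u : ℝ → ℝ} {m j : ℕ} {t : ℝ}

theorem exactFlux_of_le (h : t ≤ α) : exactFlux a b α βm βp u j t
    = βm * iteratedDerivWithin (j + 1) u (Icc a α) t := if_pos h

theorem exactFlux_of_ge (hu : MemW m a b α βm βp u) (hj : j < m) (h : α ≤ t) :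
    exactFlux a b α βm βp u j t = βp * iteratedDerivWithin (j + 1) u (Icc α b) t := by
  rcases h.eq_or_lt with rfl | h
  · rw [exactFlux_of_le le_rfl]
    exact hu.2.2.2.2.2 (j + 1) (by omega) hj
  · exact if_neg h.not_ge

theorem continuousOn_exactFlux (hu : MemW m a b α βm βp u) (ha : a < α) (hb : α < b)
    (hj : j < m) : ContinuousOn (exactFlux a b α βm βp u j) (Icc a b) := by
  rw [← Icc_union_Icc_eq_Icc ha.le hb.le]
  refine ContinuousOn.union_of_isClosed ?_ ?_ isClosed_Icc isClosed_Icc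
  · exact ((hu.2.2.2.1.continuousOn_iteratedDerivWithin (m := j + 1) (by exact_mod_cast hj)
      (uniqueDiffOn_Icc ha)).const_mul βm).congr fun t ht => exactFlux_of_le ht.2
  · exact ((hu.2.2.2.2.1.continuousOn_iteratedDerivWithin (m := j + 1) (by exact_mod_cast hj)
      (uniqueDiffOn_Icc hb)).const_mul βp).congr fun t ht => exactFlux_of_ge hu hj ht.1

theorem hasDerivAt_exactFlux (hu : MemW m a b α βm βp u) (hj : j + 1 < m) (ht : t ∈ Ioo a b)
    (hne : t ≠ α) :
    HasDerivAt (exactFlux a b α βm βp u j) (exactFlux a b α βm βp u (j + 1) t) t := by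
  rcases lt_or_gt_of_ne hne with h | h
  · rw [exactFlux_of_le h.le]
    refine ((hasDerivAt_iteratedDerivWithin hu.2.2.2.1 hj ⟨ht.1, h⟩).const_mul
      βm).congr_of_eventuallyEq ?_
    filter_upwards [Iio_mem_nhds h] with s hs using exactFlux_of_le (le_of_lt hs)
  · rw [exactFlux_of_ge hu hj h.le]
    refine ((hasDerivAt_iteratedDerivWithin hu.2.2.2.2.1 hj ⟨h, ht.2⟩).const_mul
      βp).congr_of_eventuallyEq ?_
    filter_upwards [Ioi_mem_nhds h] with s hs using exactFlux_of_ge hu (by omega) (le_of_lt hs)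

theorem abs_exactFlux_le (hu : MemW m a b α βm βp u) (ha : a < α) (hb : α < b) (hβm : 0 < βm)
    (hβp : 0 < βp) (hj : j < m) (ht : t ∈ Icc a b) :
    |exactFlux a b α βm βp u j t| ≤ max βm βp * wnorm m a b α u := by
  rcases le_total t α with h | h
  · rw [exactFlux_of_le h, abs_mul, abs_of_pos hβm]
    exact mul_le_mul (le_max_left _ _) ((abs_iteratedDerivWithin_le_sSup ha hu.2.2.2.1 hj
      ⟨ht.1, h⟩).trans (le_max_left _ _)) (abs_nonneg _) (hβm.le.trans (le_max_left _ _))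
  · rw [exactFlux_of_ge hu hj h, abs_mul, abs_of_pos hβp]
    exact mul_le_mul (le_max_right _ _) ((abs_iteratedDerivWithin_le_sSup hb hu.2.2.2.2.1 hj
      ⟨h, ht.2⟩).trans (le_max_right _ _)) (abs_nonneg _) (hβm.le.trans (le_max_left _ _))

theorem hasDerivAt_of_memW (hu : MemW m a b α βm βp u) (hm : 0 < m) (hβm : 0 < βm)
    (hβp : 0 < βp) (ht : t ∈ Ioo a b) (hne : t ≠ α) :
    HasDerivAt u (exactFlux a b α βm βp u 0 t / betaPW βm βp α t) t := by
  rcases lt_or_gt_of_ne hne with h | h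
  · have h1 := hasDerivAt_iteratedDerivWithin hu.2.2.2.1 hm ⟨ht.1, h⟩
    rw [iteratedDerivWithin_zero] at h1
    rwa [exactFlux_of_le h.le, betaPW, if_pos h, mul_div_cancel_left₀ _ hβm.ne']
  · have h1 := hasDerivAt_iteratedDerivWithin hu.2.2.2.2.1 hm ⟨h, ht.2⟩
    rw [iteratedDerivWithin_zero] at h1
    rwa [exactFlux_of_ge hu hm h.le, betaPW, if_neg h.not_gt, mul_div_cancel_left₀ _ hβp.ne']

theorem betaPW_mul_iteratedDeriv_two (hu : MemW m a b α βm βp u) (hm : 2 ≤ m)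
    (ht : t ∈ Ioo a b) (hne : t ≠ α) :
    betaPW βm βp α t * iteratedDeriv 2 u t = exactFlux a b α βm βp u 1 t := by
  rcases lt_or_gt_of_ne hne with h | h
  · rw [exactFlux_of_le h.le, betaPW, if_pos h, iteratedDeriv_two_eq hu.2.2.2.1 hm ⟨ht.1, h⟩]
  · rw [exactFlux_of_ge hu (by omega) h.le, betaPW, if_neg h.not_gt,
      iteratedDeriv_two_eq hu.2.2.2.2.1 hm ⟨h, ht.2⟩]

end ExactFlux

section DiscreteFlux

theorem Polynomial.eq_zero_of_iterate_derivative {s : Polynomial ℝ} {α : ℝ} {p : ℕ}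
    (hs : s.natDegree < p) (h : ∀ j < p, ((⇑derivative)^[j] s).eval α = 0) : s = 0 := by
  refine eq_zero_of_hasseDeriv_eq_zero s α fun j => ?_
  have h1 : ((⇑derivative)^[j] s).eval α = 0 := by
    rcases lt_or_ge j p with hj | hj
    · exact h j hj
    · rw [iterate_derivative_eq_zero (hs.trans_le hj), eval_zero]
  rw [← factorial_smul_hasseDeriv, LinearMap.smul_apply, eval_smul, smul_eq_zero] at h1
  exact h1.resolve_left (Nat.factorial_ne_zero j)

theorem natDegree_C_mul_derivative_lt {q : Polynomial ℝ} {p : ℕ} (hp : 0 < p)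
    (hq : q.natDegree ≤ p) (β : ℝ) : (Polynomial.C β * Polynomial.derivative q).natDegree < p := by
  have h1 := Polynomial.natDegree_C_mul_le β (Polynomial.derivative q)
  have h2 := Polynomial.natDegree_derivative_le q
  omega

theorem hasDerivAt_of_eq_polynomial {v : ℝ → ℝ} {q : Polynomial ℝ} {l r t β : ℝ} (hβ : 0 < β)
    (hv : ∀ y ∈ Icc l r, v y = q.eval y) (ht : t ∈ Ioo l r) :
    HasDerivAt v ((Polynomial.C β * Polynomial.derivative q).eval t / β) t := by
  rw [Polynomial.eval_mul, Polynomial.eval_C, mul_div_cancel_left₀ _ hβ.ne']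
  refine (q.hasDerivAt t).congr_of_eventuallyEq ?_
  filter_upwards [Ioo_mem_nhds ht.1 ht.2] with s hs using hv s (Ioo_subset_Icc_self hs)

/-- The flux of an immersed trial function is a single polynomial on each element. -/
theorem MemUT.exists_flux {p N k : ℕ} {a b α βm βp : ℝ} {x : ℕ → ℝ} {v : ℝ → ℝ}
    (hv : MemUT p N k a b α βm βp x v) (hp : 0 < p) (hβm : 0 < βm) (hβp : 0 < βp)
    (hx : ∀ i, i < N → x i < x (i + 1)) (hkN : k ≤ N) (hl : x (k - 1) < α)
    (hr : α < x k) :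
    ∃ Q : ℕ → Polynomial ℝ, ∀ i ∈ Finset.Icc 1 N, (Q i).natDegree < p ∧
      ∀ t ∈ Ioo (x (i - 1)) (x i), t ≠ α →
        HasDerivAt v ((Q i).eval t / betaPW βm βp α t) t := by
  have h : ∀ i ∈ Finset.Icc 1 N, ∃ Q : Polynomial ℝ, Q.natDegree < p ∧
      ∀ t ∈ Ioo (x (i - 1)) (x i), t ≠ α →
        HasDerivAt v (Q.eval t / betaPW βm βp α t) t := by
    intro i hi
    by_cases hik : i = k
    · subst hik
      obtain ⟨qm, qp, hqm, hqp, hvm, hvp, hjump⟩ := hv.2.2.2.2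
      have heq : Polynomial.C βm * Polynomial.derivative qm
          = Polynomial.C βp * Polynomial.derivative qp := by
        refine sub_eq_zero.1 (Polynomial.eq_zero_of_iterate_derivative (α := α) (p := p) ?_
          fun j hj => ?_)
        · exact (Polynomial.natDegree_sub_le _ _).trans_lt (max_lt
            (natDegree_C_mul_derivative_lt hp hqm _) (natDegree_C_mul_derivative_lt hp hqp _))
        · have h1 := hjump (j + 1) (by omega) hj
          rw [Function.iterate_succ_apply, Function.iterate_succ_apply] at h1
          rw [Polynomial.iterate_derivative_sub, Polynomial.iterate_derivative_C_mul,
            Polynomial.iterate_derivative_C_mul, Polynomial.eval_sub, Polynomial.eval_mul,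
            Polynomial.eval_mul, Polynomial.eval_C, Polynomial.eval_C, h1, sub_self]
      refine ⟨_, natDegree_C_mul_derivative_lt hp hqm βm, fun t ht hne => ?_⟩
      rcases lt_or_gt_of_ne hne with h | h
      · rw [betaPW, if_pos h]
        exact hasDerivAt_of_eq_polynomial hβm hvm ⟨ht.1, h⟩
      · rw [betaPW, if_neg h.not_gt, heq]
        exact hasDerivAt_of_eq_polynomial hβp hvp ⟨h, ht.2⟩
    · obtain ⟨b₀, hb₀, -, hβ⟩ := betaPW_eq_on_element hβm hβp hx hkN hl hr hi hik
      have hi' := Finset.mem_Icc.1 hi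
      obtain ⟨q, hq, hvq⟩ := hv.2.2.2.1 i hi'.1 hi'.2 hik
      refine ⟨_, natDegree_C_mul_derivative_lt hp hq b₀, fun t ht _ => ?_⟩
      rw [(hβ t ht).2]
      exact hasDerivAt_of_eq_polynomial hb₀ hvq ht
  choose! Q hQ using h
  exact ⟨Q, hQ⟩

end DiscreteFlux

section Balance

open MeasureTheory

/-- Integration of a function whose derivative is a flux divided by the diffusion coefficient. -/
theorem intervalIntegrable_deriv_of_flux {β v w : ℝ → ℝ} {m α l r : ℝ} (hm : 0 < m)
    (hβ : Measurable β) (hlow : ∀ t, m ≤ β t) (hlr : l ≤ r) (hv : ContinuousOn v (Icc l r))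
    (hw : ContinuousOn w (Icc l r))
    (hd : ∀ t ∈ Ioo l r, t ≠ α → HasDerivAt v (w t / β t) t) :
    IntervalIntegrable (deriv v) volume l r ∧ ∫ t in l..r, deriv v t = v r - v l := by
  have hi := intervalIntegrable_div hm hβ hlow hlr hw
  have hae : ∀ᵐ t : ℝ, t ∈ uIoc l r → w t / β t = deriv v t := by
    have hfin : ({α, r} : Set ℝ).Countable := (countable_singleton r).insert α
    filter_upwards [hfin.ae_notMem volume] with t ht htlr
    rw [uIoc_of_le hlr] at htlr
    simp only [mem_insert_iff, mem_singleton_iff, not_or] at ht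
    exact (hd t ⟨htlr.1, htlr.2.lt_of_ne ht.2⟩ ht.1).deriv.symm
  refine ⟨hi.congr_ae ((ae_restrict_iff' measurableSet_uIoc).2 hae), ?_⟩
  rw [← intervalIntegral.integral_congr_ae hae]
  refine integral_eq_of_hasDerivAt_off_countable _ _ (countable_singleton α)
    (by rwa [uIcc_of_le hlr]) (fun t ht => ?_) hi
  rw [min_eq_left hlr, max_eq_right hlr] at ht
  exact hd t ht.1 ht.2

/-- Integral form of the differential equation. -/
theorem integral_rhs_eq {p : ℕ} {a b α βm βp γ c l r : ℝ} {f u : ℝ → ℝ} (hβm : 0 < βm)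
    (hβp : 0 < βp) (hp : 2 ≤ p) (ha : a < α) (hb : α < b) (hu : MemW p a b α βm βp u)
    (hf : ∀ t, t ∈ Ioo a α ∪ Ioo α b →
      -(betaPW βm βp α t * iteratedDeriv 2 u t) + γ * deriv u t + c * u t = f t)
    (hl : a ≤ l) (hlr : l ≤ r) (hr : r ≤ b) :
    ∫ t in l..r, f t = exactFlux a b α βm βp u 0 l - exactFlux a b α βm βp u 0 r
      + γ * (u r - u l) + c * ∫ t in l..r, u t := by
  have hsub : Icc l r ⊆ Icc a b := Icc_subset_Icc hl hr
  have hsub' : ∀ t ∈ Ioo l r, t ∈ Ioo a b := fun t ht => Ioo_subset_Ioo hl hr ht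
  have hcont : ∀ j < p, ContinuousOn (exactFlux a b α βm βp u j) (Icc l r) := fun j hj =>
    (continuousOn_exactFlux hu ha hb hj).mono hsub
  obtain ⟨hi, hint⟩ := intervalIntegrable_deriv_of_flux (lt_min hβm hβp)
    (measurable_betaPW βm βp α) (betaPW_lower βm βp α) hlr (hu.1.mono hsub) (hcont 0 (by omega))
    (fun t ht hne => hasDerivAt_of_memW hu (by omega) hβm hβp (hsub' t ht) hne)
  have hi1 : IntervalIntegrable (exactFlux a b α βm βp u 1) volume l r :=
    ContinuousOn.intervalIntegrable (by rw [uIcc_of_le hlr]; exact hcont 1 (by omega))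
  have hiu : IntervalIntegrable u volume l r :=
    ContinuousOn.intervalIntegrable (by rw [uIcc_of_le hlr]; exact hu.1.mono hsub)
  have hflux : ∫ t in l..r, exactFlux a b α βm βp u 1 t
      = exactFlux a b α βm βp u 0 r - exactFlux a b α βm βp u 0 l := by
    refine integral_eq_of_hasDerivAt_off_countable _ _ (countable_singleton α)
      (by rw [uIcc_of_le hlr]; exact hcont 0 (by omega)) (fun t ht => ?_) hi1
    rw [min_eq_left hlr, max_eq_right hlr] at ht
    exact hasDerivAt_exactFlux hu (by omega) (hsub' t ht.1) ht.2
  have hae : ∀ᵐ t : ℝ, t ∈ uIoc l r →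
      f t = γ * deriv u t + c * u t - exactFlux a b α βm βp u 1 t := by
    have hfin : ({α, r} : Set ℝ).Countable := (countable_singleton r).insert α
    filter_upwards [hfin.ae_notMem volume] with t ht htlr
    rw [uIoc_of_le hlr] at htlr
    simp only [mem_insert_iff, mem_singleton_iff, not_or] at ht
    have h1 := hsub' t ⟨htlr.1, htlr.2.lt_of_ne ht.2⟩
    rw [← hf t ((lt_or_gt_of_ne ht.1).imp (fun h => ⟨h1.1, h⟩) (fun h => ⟨h, h1.2⟩)),
      betaPW_mul_iteratedDeriv_two hu hp h1 ht.1]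
    ring
  rw [intervalIntegral.integral_congr_ae hae,
    intervalIntegral.integral_sub ((hi.const_mul γ).add (hiu.const_mul c)) hi1,
    intervalIntegral.integral_add (hi.const_mul γ) (hiu.const_mul c),
    intervalIntegral.integral_const_mul, intervalIntegral.integral_const_mul, hint, hflux]
  ring

/-- A quantity conserved from each node to the next one is constant. -/
theorem eq_of_node_steps {p N : ℕ} {Ψ : ℕ → ℕ → ℝ}
    (hin : ∀ i ∈ Finset.Icc 1 N, ∀ j, 1 ≤ j → j < p → Ψ i (j + 1) = Ψ i j)
    (hnext : ∀ i, 1 ≤ i → i < N → Ψ (i + 1) 1 = Ψ i p) {i j : ℕ} (hi : i ∈ Finset.Icc 1 N)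
    (hj : j ∈ Finset.Icc 1 p) : Ψ i j = Ψ 1 1 := by
  have hrow : ∀ i ∈ Finset.Icc 1 N, ∀ j, 1 ≤ j → j ≤ p → Ψ i j = Ψ i 1 := by
    intro i hi j hj
    induction j, hj using Nat.le_induction with
    | base => exact fun _ => rfl
    | succ j hj ih => exact fun hjp => (hin i hi j hj hjp).trans (ih (by omega))
  rw [Finset.mem_Icc] at hi hj
  have hcol : ∀ i, 1 ≤ i → i ≤ N → Ψ i 1 = Ψ 1 1 := by
    intro i hi
    induction i, hi using Nat.le_induction with
    | base => exact fun _ => rfl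
    | succ i hi ih =>
      exact fun hiN => (hnext i hi hiN).trans ((hrow i (Finset.mem_Icc.2 ⟨hi, by omega⟩) p
        (by omega) le_rfl).trans (ih (by omega)))
  exact (hrow i (Finset.mem_Icc.2 hi) j hj.1 hj.2).trans (hcol i hi.1 hi.2)

end Balance

/-- The balance equations on the dual elements put the error of the finite volume solution in
flux form. -/
theorem exists_isErrorFlux {p N k : ℕ} {βm βp γ c a b α : ℝ} {x : ℕ → ℝ} {g A : ℕ → ℕ → ℝ}
    {f u uT : ℝ → ℝ} (hp : 2 ≤ p) (hβm : 0 < βm) (hβp : 0 < βp) (hc : 0 < c)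
    (hk : 1 ≤ k) (hkN : k ≤ N) (hfirst : x 0 = a) (hlast : x N = b)
    (hx : ∀ i, i < N → x i < x (i + 1)) (hl : x (k - 1) < α) (hr : α < x k)
    (hrule : ∀ i ∈ Finset.Icc 1 N, IsGaussRule p (min βm βp) (max βm βp) (betaPW βm βp α)
      (x (i - 1)) (x i) (g i) (A i))
    (hne : ∀ i ∈ Finset.Icc 1 N, ∀ j ∈ Finset.Icc 1 p, g i j ≠ α)
    (hmono : ∀ i ∈ Finset.Icc 1 N, ∀ j, 1 ≤ j → j < p → g i j < g i (j + 1))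
    (hnext : ∀ i, 1 ≤ i → i < N → g i (p + 1) = g (i + 1) 1)
    (hu : MemW (2 * p + 1) a b α βm βp u)
    (hf : ∀ t, t ∈ Ioo a α ∪ Ioo α b →
      -(betaPW βm βp α t * iteratedDeriv 2 u t) + γ * deriv u t + c * u t = f t)
    (huT : MemUT p N k a b α βm βp x uT)
    (hbal : ∀ i, 1 ≤ i → i ≤ N → ∀ j, 1 ≤ j → j ≤ (if i < N then p else p - 1) →
      betaPW βm βp α (g i j) * deriv uT (g i j)
        - betaPW βm βp α (g i (j + 1)) * deriv uT (g i (j + 1))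
        + (∫ t in (g i j)..(g i (j + 1)), (γ * deriv uT t + c * uT t))
        = ∫ t in (g i j)..(g i (j + 1)), f t) :
    ∃ (K : ℝ) (e : ℝ → ℝ) (D : ℕ → ℝ → ℝ) (Q : ℕ → Polynomial ℝ),
      IsErrorFlux p N k βm βp γ c (max βm βp * wnorm (2 * p + 1) a b α u) a b α K x g A e D Q ∧
      ∀ t ∈ Icc a b, e t = u t - uT t := by
  have hleft : ∀ i ≤ N, a ≤ x i := fun i hi => hfirst ▸ mesh_mono hx (Nat.zero_le i) hi
  have hright : ∀ i ≤ N, x i ≤ b := fun i hi => hlast ▸ mesh_mono hx hi le_rfl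
  have ha : a < α := (hleft (k - 1) (by omega)).trans_lt hl
  have hb : α < b := hr.trans_le (hright k hkN)
  have hab : a ≤ b := (ha.trans hb).le
  have hsub : ∀ i ∈ Finset.Icc 1 N, Icc (x (i - 1)) (x i) ⊆ Icc a b := fun i hi => by
    rw [Finset.mem_Icc] at hi
    exact Icc_subset_Icc (hleft _ (by omega)) (hright _ hi.2)
  have hsub' : ∀ i ∈ Finset.Icc 1 N, Ioo (x (i - 1)) (x i) ⊆ Ioo a b := fun i hi => by
    rw [Finset.mem_Icc] at hi
    exact Ioo_subset_Ioo (hleft _ (by omega)) (hright _ hi.2)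
  obtain ⟨Q, hQ⟩ := huT.exists_flux (by omega) hβm hβp hx hkN hl hr
  set D := exactFlux a b α βm βp u with hD
  set e : ℝ → ℝ := IccExtend hab (fun t : Icc a b => u t - uT t) with he
  have heq : ∀ t ∈ Icc a b, e t = u t - uT t := fun t ht => IccExtend_of_mem hab _ ht
  have hec : Continuous e := by
    have h1 := hu.1.domRestrict
    have h2 := huT.1.domRestrict
    exact (h1.sub h2).Icc_extend'
  set Ψ : ℕ → ℕ → ℝ := fun i j => D 0 (g i j) - (Q i).eval (g i j) - γ * e (g i j)
    - c * ∫ s in a..g i j, e s with hΨ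
  have hmem : ∀ i ∈ Finset.Icc 1 N, ∀ j ∈ Finset.Icc 1 p, g i j ∈ Ioo (x (i - 1)) (x i) :=
    fun i hi => (hrule i hi).mem
  have hflux : ∀ i ∈ Finset.Icc 1 N, ∀ j ∈ Finset.Icc 1 p,
      betaPW βm βp α (g i j) * deriv uT (g i j) = (Q i).eval (g i j) := fun i hi j hj => by
    rw [((hQ i hi).2 _ (hmem i hi j hj) (hne i hi j hj)).deriv]
    exact mul_div_cancel₀ _ ((lt_min hβm hβp).trans_le (betaPW_lower βm βp α _)).ne'
  have hiu : ∀ l r, a ≤ l → l ≤ r → r ≤ b → IntervalIntegrable u MeasureTheory.volume l r :=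
    fun l r hal hlr hrb => ContinuousOn.intervalIntegrable
      (by rw [uIcc_of_le hlr]; exact hu.1.mono (Icc_subset_Icc hal hrb))
  have hiT : ∀ l r, a ≤ l → l ≤ r → r ≤ b → IntervalIntegrable uT MeasureTheory.volume l r :=
    fun l r hal hlr hrb => ContinuousOn.intervalIntegrable
      (by rw [uIcc_of_le hlr]; exact huT.1.mono (Icc_subset_Icc hal hrb))
  have hderiv : ∀ i ∈ Finset.Icc 1 N, ∀ l r, x (i - 1) ≤ l → l ≤ r → r ≤ x i →
      IntervalIntegrable (deriv uT) MeasureTheory.volume l r ∧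
        ∫ t in l..r, deriv uT t = uT r - uT l := fun i hi l r hxl hlr hrx =>
    intervalIntegrable_deriv_of_flux (lt_min hβm hβp) (measurable_betaPW βm βp α)
      (betaPW_lower βm βp α) hlr (huT.1.mono ((Icc_subset_Icc hxl hrx).trans (hsub i hi)))
      (Q i).continuous.continuousOn
      (fun t ht => (hQ i hi).2 t (Ioo_subset_Ioo hxl hrx ht))
  have hstep : ∀ l r q q' : ℝ, a ≤ l → l ≤ r → r ≤ b →
      (IntervalIntegrable (deriv uT) MeasureTheory.volume l r ∧
        ∫ t in l..r, deriv uT t = uT r - uT l) →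
      q - q' + (∫ t in l..r, (γ * deriv uT t + c * uT t)) = ∫ t in l..r, f t →
      D 0 r - q' - γ * e r - c * (∫ s in a..r, e s)
        = D 0 l - q - γ * e l - c * ∫ s in a..l, e s := by
    intro l r q q' hal hlr hrb hT hq
    have h1 := hiu l r hal hlr hrb
    have h2 := hiT l r hal hlr hrb
    rw [integral_rhs_eq hβm hβp (by omega) ha hb hu hf hal hlr hrb,
      intervalIntegral.integral_add (hT.1.const_mul γ) (h2.const_mul c),
      intervalIntegral.integral_const_mul, intervalIntegral.integral_const_mul, hT.2] at hq
    have h3 : ∫ s in l..r, e s = (∫ t in l..r, u t) - ∫ t in l..r, uT t := by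
      rw [← intervalIntegral.integral_sub h1 h2]
      refine intervalIntegral.integral_congr fun t ht => ?_
      rw [uIcc_of_le hlr] at ht
      exact heq t ⟨hal.trans ht.1, ht.2.trans hrb⟩
    have h4 : (∫ s in a..r, e s) - ∫ s in a..l, e s = ∫ s in l..r, e s :=
      intervalIntegral.integral_interval_sub_left (hec.intervalIntegrable _ _)
        (hec.intervalIntegrable _ _)
    rw [heq r ⟨hal.trans hlr, hrb⟩, heq l ⟨hal, hlr.trans hrb⟩]
    have h5 : c * (∫ s in a..r, e s) = c * (∫ s in a..l, e s)
        + c * ((∫ t in l..r, u t) - ∫ t in l..r, uT t) := by rw [← h3, ← h4]; ring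
    rw [h5]
    simp only [hD]
    linarith
  have hin : ∀ i ∈ Finset.Icc 1 N, ∀ j, 1 ≤ j → j < p → Ψ i (j + 1) = Ψ i j := by
    intro i hi j hj hjp
    have hi' := Finset.mem_Icc.1 hi
    have hj1 : j ∈ Finset.Icc 1 p := Finset.mem_Icc.2 ⟨hj, hjp.le⟩
    have hj2 : j + 1 ∈ Finset.Icc 1 p := Finset.mem_Icc.2 ⟨by omega, hjp⟩
    have h1 := hmem i hi j hj1
    have h2 := hmem i hi (j + 1) hj2
    have hlt := (hmono i hi j hj hjp).le
    have h3 := hbal i hi'.1 hi'.2 j hj (by split_ifs <;> omega)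
    rw [hflux i hi j hj1, hflux i hi (j + 1) hj2] at h3
    exact hstep _ _ _ _ (hsub i hi (Ioo_subset_Icc_self h1)).1 hlt
      (hsub i hi (Ioo_subset_Icc_self h2)).2 (hderiv i hi _ _ h1.1.le hlt h2.2.le) h3
  have hout : ∀ i, 1 ≤ i → i < N → Ψ (i + 1) 1 = Ψ i p := by
    intro i hi hiN
    have hi1 : i ∈ Finset.Icc 1 N := Finset.mem_Icc.2 ⟨hi, hiN.le⟩
    have hi2 : i + 1 ∈ Finset.Icc 1 N := Finset.mem_Icc.2 ⟨by omega, hiN⟩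
    have hjp : p ∈ Finset.Icc 1 p := Finset.mem_Icc.2 ⟨by omega, le_rfl⟩
    have hj1 : 1 ∈ Finset.Icc 1 p := Finset.mem_Icc.2 ⟨le_rfl, by omega⟩
    have h1 := hmem i hi1 p hjp
    have h2 := hmem (i + 1) hi2 1 hj1
    have h3 := hbal i hi hiN.le p (by omega) (by rw [if_pos hiN])
    rw [hnext i hi hiN, hflux i hi1 p hjp, hflux (i + 1) hi2 1 hj1] at h3
    have hT1 := hderiv i hi1 (g i p) (x i) h1.1.le h1.2.le le_rfl
    have hT2 := hderiv (i + 1) hi2 (x i) (g (i + 1) 1) le_rfl h2.1.le h2.2.le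
    refine hstep _ _ _ _ (hsub i hi1 (Ioo_subset_Icc_self h1)).1 (h1.2.trans h2.1).le
      (hsub (i + 1) hi2 (Ioo_subset_Icc_self h2)).2 ⟨hT1.1.trans hT2.1, ?_⟩ h3
    rw [← intervalIntegral.integral_add_adjacent_intervals hT1.1 hT2.1, hT1.2, hT2.2]
    ring
  refine ⟨Ψ 1 1, e, D, Q, ?_, heq⟩
  exact
    { two_le := hp
      betaM_pos := hβm
      betaP_pos := hβp
      c_pos := hc
      one_le_k := hk
      k_le := hkN
      first := hfirst
      last := hlast
      step := hx
      lt_interface := hl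
      interface_lt := hr
      rule := hrule
      continuous_e := hec
      e_left := by rw [heq a (left_mem_Icc.2 hab), hu.2.1, huT.2.1, sub_zero]
      e_right := by rw [heq b (right_mem_Icc.2 hab), hu.2.2.1, huT.2.2.1, sub_zero]
      continuousOn_D := fun j hj => continuousOn_exactFlux hu ha hb (by omega)
      hasDerivAt_D := fun j hj t ht hne => hasDerivAt_exactFlux hu (by omega) ht hne
      abs_D_le := fun j hj t ht => abs_exactFlux_le hu ha hb hβm hβp (by omega) ht
      natDegree_Q := fun i hi => (hQ i hi).1
      hasDerivAt_e := fun i hi t ht hne => by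
        have ht' := hsub' i hi ht
        rw [sub_div]
        refine ((hasDerivAt_of_memW hu (by omega) hβm hβp ht' hne).sub
          ((hQ i hi).2 t ht hne)).congr_of_eventuallyEq ?_
        filter_upwards [Ioo_mem_nhds ht'.1 ht'.2] with s hs using heq s (Ioo_subset_Icc_self hs)
      node := fun i hi j hj => by
        have h1 : Ψ i j = Ψ 1 1 := eq_of_node_steps hin hout hi hj
        rw [lowerOrder, ← h1]
        simp only [hΨ]
        ring }

/-- under the hypotheses of the superconvergence theorem, at every root `z` of
the generalized Lobatto function `φᵢ(x) = ∫_{x_{i-1}}^x Lᵢ/β` of degree `p+1` on the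
element `τᵢ` (a generalized Lobatto point), `|u(z) − u_T(z)| ≤ C h^{p+2} ‖u‖_{2p+1,∞}`. -/
theorem stmt_16 (p : ℕ) (hp : 2 ≤ p) (βm βp γ c κ σ d : ℝ)
    (hβm : 0 < βm) (hβp : 0 < βp) (hc : 0 < c) (hκ : 0 < κ) (hσ : 0 < σ) (hd : 0 < d) :
    ∃ h₀ C : ℝ, 0 < h₀ ∧ 0 < C ∧
    (∀ (N k : ℕ) (a b α hm : ℝ) (x : ℕ → ℝ) (g A : ℕ → ℕ → ℝ),
    b - a = d →
    1 ≤ N →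
    1 ≤ k →
    k ≤ N →
    a < b →
    x 0 = a →
    x N = b →
    (∀ i, i < N → x i < x (i + 1)) →
    x (k - 1) < α →
    α < x k →
    (∀ i ∈ Finset.Icc 1 N, ∀ j ∈ Finset.Icc 1 p,
      x (i - 1) < g i j ∧ g i j < x i ∧ g i j ≠ α) →
    (∀ i ∈ Finset.Icc 1 N, ∀ j, 1 ≤ j → j < p → g i j < g i (j + 1)) →
    (∀ i, 1 ≤ i → i < N → g i (p + 1) = g (i + 1) 1) →
    (∀ i ∈ Finset.Icc 1 N, ∀ j ∈ Finset.Icc 1 p, 0 < A i j) →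
    (∀ i ∈ Finset.Icc 1 N, ∀ F : Polynomial ℝ, F.natDegree ≤ 2 * p - 1 →
      ∑ j ∈ Finset.Icc 1 p, A i j * F.eval (g i j)
        = ∫ t in (x (i - 1))..(x i), F.eval t / betaPW βm βp α t) →
    (∀ i ∈ Finset.Icc 1 N, ∀ j ∈ Finset.Icc 1 p, κ * (x i - x (i - 1)) ≤ A i j) →
    (∀ i ∈ Finset.Icc 1 N, ∀ i' ∈ Finset.Icc 1 N,
      x i - x (i - 1) ≤ σ * (x i' - x (i' - 1))) →
    (∀ i ∈ Finset.Icc 1 N, x i - x (i - 1) ≤ hm) →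
    hm ≤ h₀ →
    ∀ (f u uT : ℝ → ℝ),
    ContinuousOn f (Set.Ioo a α ∪ Set.Ioo α b) →
    (∃ Mf : ℝ, ∀ t ∈ Set.Icc a b, |f t| ≤ Mf) →
    MemW (2 * p + 1) a b α βm βp u →
    (∀ t, t ∈ Set.Ioo a α ∪ Set.Ioo α b →
      -(betaPW βm βp α t * iteratedDeriv 2 u t) + γ * deriv u t + c * u t = f t) →
    MemUT p N k a b α βm βp x uT →
    (∀ i, 1 ≤ i → i ≤ N → ∀ j, 1 ≤ j → j ≤ (if i < N then p else p - 1) →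
      betaPW βm βp α (g i j) * deriv uT (g i j)
        - betaPW βm βp α (g i (j + 1)) * deriv uT (g i (j + 1))
        + (∫ t in (g i j)..(g i (j + 1)), (γ * deriv uT t + c * uT t))
        = ∫ t in (g i j)..(g i (j + 1)), f t) →
    ∀ i ∈ Finset.Icc 1 N, ∀ L : Polynomial ℝ, L.degree = (p : WithBot ℕ) →
    (∀ q : Polynomial ℝ, q.natDegree < p →
      ∫ t in (x (i - 1))..(x i), L.eval t * q.eval t / betaPW βm βp α t = 0) →
    ∀ z ∈ Set.Icc (x (i - 1)) (x i),
      (∫ t in (x (i - 1))..z, L.eval t / betaPW βm βp α t) = 0 →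
      |u z - uT z| ≤ C * hm ^ (p + 2) * wnorm (2 * p + 1) a b α u) := by
  obtain ⟨h₀, C, hh₀, hC, H⟩ := IsErrorFlux.exists_lobatto_bound p βm βp γ c d hβm hβp hc hd
  refine ⟨h₀, C * max βm βp, hh₀, by positivity, ?_⟩
  intro N k a b α hm x g A hab _ hk hkN _ hfirst hlast hx hl hr hg hmono hnext hA hexact _ _
    hlen hhm f u uT _ _ hu hf huT hbal i hi L hL horth z hz hLz
  have hrule : ∀ i ∈ Finset.Icc 1 N, IsGaussRule p (min βm βp) (max βm βp) (betaPW βm βp α)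
      (x (i - 1)) (x i) (g i) (A i) := by
    intro i hi
    have hlt : ∀ j ∈ Finset.Icc 1 p, ∀ l ∈ Finset.Icc 1 p, j < l → g i j < g i l := by
      intro j hj l hl hjl
      rw [Finset.mem_Icc] at hj hl
      obtain ⟨-, hl⟩ := hl
      induction l, Nat.succ_le_of_lt hjl using Nat.le_induction with
      | base => exact hmono i hi j hj.1 (by omega)
      | succ l hjl' ih => exact (ih (by omega) (by omega)).trans (hmono i hi l (by omega) (by omega))
    have hone : 1 ∈ Finset.Icc 1 p := Finset.mem_Icc.2 ⟨le_rfl, by omega⟩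
    exact
      { one_le := by omega
        lt := (hg i hi 1 hone).1.trans (hg i hi 1 hone).2.1
        pos := lt_min hβm hβp
        meas := measurable_betaPW βm βp α
        lower := betaPW_lower βm βp α
        upper := betaPW_upper βm βp α
        mem := fun j hj => ⟨(hg i hi j hj).1, (hg i hi j hj).2.1⟩
        ne := fun j hj l hl hjl => (lt_or_gt_of_ne hjl).elim
          (fun h => (hlt j hj l hl h).ne) (fun h => (hlt l hl j hj h).ne')
        weight_pos := hA i hi
        exact := hexact i hi }
  obtain ⟨K, e, D, Q, S, heq⟩ := exists_isErrorFlux hp hβm hβp hc hk hkN hfirst hlast hx hl hr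
    hrule (fun i hi j hj => (hg i hi j hj).2.2) hmono hnext hu hf huT hbal
  have h := H N k _ a b α K hm x g A e D Q S hab hlen hhm i hi L hL horth z hz hLz
  rw [heq z (S.element_subset hi hz)] at h
  exact h.trans (le_of_eq (by ring))
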